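/- arXiv:1805.04373 — 6 statements merged into one kernel-verified Lean document; each statement's English description precedes it below -/
import Mathlib

section
/- Let H be a finite-dimensional complex inner product space and C a conjugation on H. Let h be a self-adjoint positive definite operator on H, let γ be a self-adjoint positive semidefinite operator on H, and let k, α be linear operators on H such that α* (1 + C γ C)⁻¹ α ≤ γ and k h⁻¹ k* ≤ C h C. Then Tr(h γ) + Re Tr(k* α) ≥ −(1/2) · Tr(k h⁻¹ k*). -/
open scoped InnerProductSpace

theorem aux_trace_nonneg {H : Type*} [NormedAddCommGroup H] [InnerProductSpace ℂ H]
    [FiniteDimensional ℂ H] (P Q : H →ₗ[ℂ] H)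
    (hP : ∀ x y : H, ⟪P x, y⟫_ℂ = ⟪x, P y⟫_ℂ)
    (hP0 : ∀ x : H, 0 ≤ (⟪x, P x⟫_ℂ).re) (hQ0 : ∀ x : H, 0 ≤ (⟪x, Q x⟫_ℂ).re) :
    0 ≤ (LinearMap.trace ℂ H (P * Q)).re := by
  have hs : P.IsSymmetric := hP
  let b := hs.eigenvectorBasis rfl
  rw [LinearMap.trace_eq_sum_inner _ b, Complex.re_sum]
  refine Finset.sum_nonneg fun i _ => ?_
  have e : P (b i) = ((hs.eigenvalues rfl i : ℝ) : ℂ) • b i := hs.apply_eigenvectorBasis rfl i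
  have h1 := hP0 (b i)
  rw [e, inner_smul_right, inner_self_eq_norm_sq_to_K, b.norm_eq_one] at h1
  rw [Module.End.mul_apply, ← hP, e, inner_smul_left, Complex.conj_ofReal, Complex.re_ofReal_mul]
  refine mul_nonneg ?_ (hQ0 _)
  simpa using h1

theorem aux_trace_conj {H : Type*} [NormedAddCommGroup H] [InnerProductSpace ℂ H]
    [FiniteDimensional ℂ H] (C : H → H)
    (hC_inner : ∀ f g : H, ⟪C f, C g⟫_ℂ = ⟪g, f⟫_ℂ)
    (hC_invol : ∀ f, C (C f) = f) (X Y : H →ₗ[ℂ] H) (hY : ∀ f, Y f = C (X (C f))) :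
    (LinearMap.trace ℂ H Y).re = (LinearMap.trace ℂ H X).re := by
  let b := stdOrthonormalBasis ℂ H
  have ho : Orthonormal ℂ (fun i => C (b i)) := by
    rw [orthonormal_iff_ite]
    intro i j
    rw [hC_inner, orthonormal_iff_ite.mp b.orthonormal]
    simp [eq_comm]
  let b' := OrthonormalBasis.mk ho
    (ho.linearIndependent.span_eq_top_of_card_eq_finrank' (by simp)).ge
  have hb' : ∀ i, b' i = C (b i) := fun i => by simp [b']
  rw [LinearMap.trace_eq_sum_inner _ b, LinearMap.trace_eq_sum_inner _ b', Complex.re_sum,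
    Complex.re_sum]
  refine Finset.sum_congr rfl fun i _ => ?_
  rw [hb', hY]
  conv_lhs => rw [← hC_invol (b i), hC_inner, hC_invol]
  exact inner_re_symm (𝕜 := ℂ) _ _

/-- lower bound for the Bogoliubov Hamiltonian, finite dimension.
Let `H` be a finite-dimensional complex inner product space, `C` a conjugation on
`H`, `h` self-adjoint positive definite, `γ` self-adjoint positive semidefinite,
and `k`, `α` operators with `α*(1 + CγC)⁻¹α ≤ γ` and `k h⁻¹ k* ≤ C h C`.
Then `Tr(hγ) + Re Tr(k*α) ≥ −(1/2)·Tr(k h⁻¹ k*)`.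
The inverses `(1 + CγC)⁻¹` and `h⁻¹` are encoded by two-sided inverse hypotheses, and
the conjugated operators `CγC`, `ChC` by pointwise descriptions. -/
theorem quadratic_hamiltonian_lower_bound
    {H : Type*} [NormedAddCommGroup H] [InnerProductSpace ℂ H] [FiniteDimensional ℂ H]
    -- the conjugation C
    (C : H → H)
    (hC_add : ∀ f g, C (f + g) = C f + C g)
    (hC_smul : ∀ (a : ℂ) (f : H), C (a • f) = (starRingEnd ℂ a) • C f)
    (hC_inner : ∀ f g : H, ⟪C f, C g⟫_ℂ = ⟪g, f⟫_ℂ)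
    (hC_invol : ∀ f, C (C f) = f)
    -- the operators
    (h γ k α : H →ₗ[ℂ] H)
    -- h is self-adjoint and positive definite
    (hh_sa : LinearMap.adjoint h = h)
    (hh_pos : ∀ x : H, x ≠ 0 → 0 < (⟪x, h x⟫_ℂ).re)
    -- γ is self-adjoint and positive semidefinite
    (hγ_sa : LinearMap.adjoint γ = γ)
    (hγ_pos : ∀ x : H, 0 ≤ (⟪x, γ x⟫_ℂ).re)
    -- h⁻¹
    (hinv : H →ₗ[ℂ] H)
    (h_hinv₁ : hinv ∘ₗ h = LinearMap.id) (h_hinv₂ : h ∘ₗ hinv = LinearMap.id)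
    -- CγC and ChC
    (γbar : H →ₗ[ℂ] H) (hγbar : ∀ f, γbar f = C (γ (C f)))
    (hbar : H →ₗ[ℂ] H) (hhbar : ∀ f, hbar f = C (h (C f)))
    -- (1 + CγC)⁻¹
    (R : H →ₗ[ℂ] H)
    (hR₁ : R ∘ₗ (LinearMap.id + γbar) = LinearMap.id)
    (hR₂ : (LinearMap.id + γbar) ∘ₗ R = LinearMap.id)
    -- α* (1 + CγC)⁻¹ α ≤ γ
    (h_α_le : ∀ x : H, 0 ≤ (⟪x, (γ - LinearMap.adjoint α ∘ₗ R ∘ₗ α) x⟫_ℂ).re)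
    -- k h⁻¹ k* ≤ C h C
    (h_k_le : ∀ x : H, 0 ≤ (⟪x, (hbar - k ∘ₗ hinv ∘ₗ LinearMap.adjoint k) x⟫_ℂ).re) :
    (LinearMap.trace ℂ H (h ∘ₗ γ)).re + (LinearMap.trace ℂ H (LinearMap.adjoint k ∘ₗ α)).re ≥
      -(1 / 2) * (LinearMap.trace ℂ H (k ∘ₗ hinv ∘ₗ LinearMap.adjoint k)).re := by
  have hsym : ∀ x y, ⟪h x, y⟫_ℂ = ⟪x, h y⟫_ℂ := fun x y => by
    rw [← LinearMap.adjoint_inner_right, hh_sa]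
  have γsym : ∀ x y, ⟪γ x, y⟫_ℂ = ⟪x, γ y⟫_ℂ := fun x y => by
    rw [← LinearMap.adjoint_inner_right, hγ_sa]
  have hpos : ∀ x : H, 0 ≤ (⟪x, h x⟫_ℂ).re := fun x => by
    by_cases hx : x = 0
    · simp [hx]
    · exact (hh_pos x hx).le
  have hhi : ∀ x, h (hinv x) = x := fun x => LinearMap.congr_fun h_hinv₂ x
  have hAR : ∀ x, R x + γbar (R x) = x := fun x => LinearMap.congr_fun hR₂ x
  have hisym : ∀ x y, ⟪hinv x, y⟫_ℂ = ⟪x, hinv y⟫_ℂ := fun x y => by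
    conv_lhs => rw [← hhi y, ← hsym, hhi]
  have hipos : ∀ x : H, 0 ≤ (⟪x, hinv x⟫_ℂ).re := fun x => by
    have := hpos (hinv x)
    rwa [← hsym, hhi] at this
  have hC2 : ∀ f g, ⟪C f, g⟫_ℂ = ⟪C g, f⟫_ℂ := fun f g => by
    conv_lhs => rw [← hC_invol g, hC_inner]
  have hC3 : ∀ f g, ⟪f, C g⟫_ℂ = ⟪g, C f⟫_ℂ := fun f g => by
    conv_lhs => rw [← hC_invol f, hC_inner]
  have gbsym : ∀ x y, ⟪γbar x, y⟫_ℂ = ⟪x, γbar y⟫_ℂ := fun x y => by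
    rw [hγbar, hγbar, hC2, hC3, γsym]
  have gbpos : ∀ x : H, 0 ≤ (⟪x, γbar x⟫_ℂ).re := fun x => by
    rw [hγbar, hC3, γsym]; exact hγ_pos _
  have Rpos : ∀ x : H, 0 ≤ (⟪x, R x⟫_ℂ).re := fun x => by
    have h1 := gbpos (R x)
    have h2 : 0 ≤ (⟪R x, R x⟫_ℂ).re := inner_self_nonneg (𝕜 := ℂ)
    have h3 : ⟪x, R x⟫_ℂ = ⟪R x, R x⟫_ℂ + ⟪R x, γbar (R x)⟫_ℂ := by
      rw [← gbsym, ← inner_add_left, hAR]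
    rw [h3, Complex.add_re]
    exact add_nonneg h2 h1
  have t1 := aux_trace_nonneg h _ hsym hpos h_α_le
  have t2 := aux_trace_nonneg γbar _ gbsym gbpos h_k_le
  have tc : (LinearMap.trace ℂ H (γbar * hbar)).re = (LinearMap.trace ℂ H (γ * h)).re :=
    aux_trace_conj C hC_inner hC_invol _ _ fun f => by
      simp [hγbar, hhbar, hC_invol]
  have gbadj : LinearMap.adjoint γbar = γbar :=
    ((LinearMap.eq_adjoint_iff _ _).mpr gbsym).symm
  have t3 := aux_trace_nonneg hinv
    (LinearMap.adjoint (α * h + (1 + γbar) * k) * R * (α * h + (1 + γbar) * k)) hisym hipos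
    (fun x => by
      rw [Module.End.mul_apply, Module.End.mul_apply, LinearMap.adjoint_inner_right]
      exact Rpos _)
  have hadj : LinearMap.adjoint (α * h + (1 + γbar) * k)
      = h * LinearMap.adjoint α + LinearMap.adjoint k * (1 + γbar) := by
    have e1 : LinearMap.adjoint (1 : H →ₗ[ℂ] H) = 1 := LinearMap.adjoint_id
    rw [map_add, Module.End.mul_eq_comp, Module.End.mul_eq_comp, LinearMap.adjoint_comp,
      LinearMap.adjoint_comp, map_add, gbadj, hh_sa, e1]
    rfl
  have hadjtr : (LinearMap.trace ℂ H (LinearMap.adjoint α * k)).re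
      = (LinearMap.trace ℂ H (LinearMap.adjoint k * α)).re := by
    let b := stdOrthonormalBasis ℂ H
    rw [LinearMap.trace_eq_sum_inner _ b, LinearMap.trace_eq_sum_inner _ b, Complex.re_sum,
      Complex.re_sum]
    refine Finset.sum_congr rfl fun i _ => ?_
    rw [Module.End.mul_apply, Module.End.mul_apply, LinearMap.adjoint_inner_right,
      LinearMap.adjoint_inner_right]
    exact inner_re_symm (𝕜 := ℂ) _ _
  rw [hadj] at t3
  simp only [← Module.End.mul_eq_comp] at *
  have r1 : R * (1 + γbar) = 1 := hR₁
  have r2 : (1 + γbar) * R = 1 := hR₂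
  have i1 : hinv * h = 1 := h_hinv₁
  have i2 : h * hinv = 1 := h_hinv₂
  generalize LinearMap.adjoint α = α' at *
  generalize LinearMap.adjoint k = k' at *
  have ex : hinv * ((h * α' + k' * (1 + γbar)) * R * (α * h + (1 + γbar) * k))
      = (hinv * h) * (α' * R * α * h) + (hinv * h) * α' * (R * (1 + γbar)) * k
        + hinv * k' * ((1 + γbar) * R) * α * h
        + hinv * k' * ((1 + γbar) * R) * (1 + γbar) * k := by
    simp only [mul_add, add_mul, mul_assoc]
    abel
  rw [ex, i1, r1, r2] at t3
  have c1 := LinearMap.trace_mul_comm ℂ (α' * R * α) h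
  have c2 : LinearMap.trace ℂ H (hinv * k' * α * h) = LinearMap.trace ℂ H (k' * α) := by
    rw [LinearMap.trace_mul_comm, ← mul_assoc, ← mul_assoc, i2, one_mul]
  have c3 := LinearMap.trace_mul_comm ℂ (hinv * k') k
  have c4 := LinearMap.trace_mul_comm ℂ (hinv * k' * γbar) k
  have c5 := LinearMap.trace_mul_comm ℂ (k * hinv * k') γbar
  have c6 := LinearMap.trace_mul_comm ℂ γ h
  simp only [mul_add, add_mul, mul_sub, mul_one, one_mul, map_add, map_sub, Complex.add_re,
    Complex.sub_re, mul_assoc] at *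
  rw [c1, c2, c3, c4, c5] at t3
  rw [c6] at tc
  linarith
end

section
/- Let H be a separable complex Hilbert space with a conjugation C, let K := H ⊕ H be the Hilbert space direct sum, and let 𝒥 : K → K be the anti-unitary involution 𝒥(f, g) := (Cg, Cf). Let B be a bounded self-adjoint operator on K with 𝒥 B 𝒥 = −B and such that the dimension of Ker(B) is either even (possibly 0) or infinite. Then there exists a unitary operator 𝒰 on K with 𝒥 𝒰 𝒥 = 𝒰 and a bounded self-adjoint positive semidefinite operator ξ on H such that, in block form with respect to K = H ⊕ H, 𝒰 B 𝒰* = [[ξ, 0], [0, −C ξ C]]. Moreover, if Ker(B) = {0}, then ξ can be chosen with Ker(ξ) = {0}. -/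
open scoped InnerProductSpace

noncomputable section

variable {H : Type*} [NormedAddCommGroup H] [InnerProductSpace ℂ H]

/-- The Hilbert direct sum `K = H ⊕ H`. -/
abbrev DirectSum2 (H : Type*) [NormedAddCommGroup H] [InnerProductSpace ℂ H] :=
  WithLp 2 (H × H)

/-- The element `(f, g)` of `K = H ⊕ H`. -/
def pairK (f g : H) : DirectSum2 H := (WithLp.equiv 2 (H × H)).symm (f, g)

/-- First component of an element of `K = H ⊕ H`. -/
def fstK (x : DirectSum2 H) : H := (WithLp.equiv 2 (H × H) x).1

/-- Second component of an element of `K = H ⊕ H`. -/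
def sndK (x : DirectSum2 H) : H := (WithLp.equiv 2 (H × H) x).2

/-- The anti-unitary involution `𝒥(f, g) = (Cg, Cf)` on `K = H ⊕ H` associated to a
conjugation `C` on `H`. -/
def Jmap (C : H → H) (x : DirectSum2 H) : DirectSum2 H := pairK (C (sndK x)) (C (fstK x))

theorem aux_countable {E : Type*} [NormedAddCommGroup E] [InnerProductSpace ℂ E]
    [TopologicalSpace.SeparableSpace E] {ι : Type*} (b : ι → E) (hb : Orthonormal ℂ b) :
    Countable ι := by
  refine Pairwise.countable_of_isOpen_disjoint (s := fun i => Metric.ball (b i) (1/2)) ?_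
    (fun i => Metric.isOpen_ball) (fun i => ⟨b i, Metric.mem_ball_self (by norm_num)⟩)
  intro i j hij
  refine Metric.ball_disjoint_ball ?_
  have h : ‖b i - b j‖ ^ 2 = 2 := by
    rw [@norm_sub_sq ℂ]
    simp [hb.1, hb.2 hij]
    norm_num
  rw [dist_eq_norm]
  nlinarith [norm_nonneg (b i - b j)]

theorem aux_basis {E : Type*} [NormedAddCommGroup E] [InnerProductSpace ℂ E] [CompleteSpace E]
    [TopologicalSpace.SeparableSpace E] (h : ¬ FiniteDimensional ℂ E) :
    Nonempty (HilbertBasis ℕ ℂ E) := by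
  obtain ⟨w, b, hb⟩ := exists_hilbertBasis ℂ E
  have hc : Countable w := aux_countable _ b.orthonormal
  have hi : Infinite w := by
    by_contra hf
    rw [not_infinite_iff_finite] at hf
    have := Fintype.ofFinite w
    exact h b.toOrthonormalBasis.toBasis.finiteDimensional_of_finite
  obtain ⟨e⟩ := nonempty_denumerable w
  let f : ℕ ≃ w := (Denumerable.eqv w).symm
  refine ⟨HilbertBasis.mk (v := fun n => b (f n)) (b.orthonormal.comp _ f.injective) ?_⟩
  have : Set.range (fun n => b (f n)) = Set.range b := f.surjective.range_comp b
  rw [this, b.dense_span]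

theorem aux_finrank_le {K : Type*} [NormedAddCommGroup K] [InnerProductSpace ℂ K]
    [FiniteDimensional ℂ K] (J : K →ₗ⋆[ℂ] K) (hJi : ∀ x y, ⟪J x, J y⟫_ℂ = ⟪y, x⟫_ℂ)
    (M N : Submodule ℂ K) (h : ∀ x ∈ M, J x ∈ N) :
    Module.finrank ℂ M ≤ Module.finrank ℂ N := by
  let b := stdOrthonormalBasis ℂ M
  let c : Fin (Module.finrank ℂ M) → N := fun i => ⟨J (b i), h _ (b i).2⟩
  have hc : Orthonormal ℂ c := by
    have hb := b.orthonormal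
    rw [orthonormal_iff_ite] at hb ⊢
    intro i j
    have := hb j i
    simp only [Submodule.coe_inner] at this ⊢
    simp only [c, hJi, this, eq_comm]
  simpa using hc.linearIndependent.fintype_card_le_finrank

/-- Existence of the isometry onto the positive half. -/
theorem aux_iso {H K : Type*} [NormedAddCommGroup H] [InnerProductSpace ℂ H] [CompleteSpace H]
    [TopologicalSpace.SeparableSpace H]
    [NormedAddCommGroup K] [InnerProductSpace ℂ K] [CompleteSpace K]
    [TopologicalSpace.SeparableSpace K] (e : K ≃ₗ[ℂ] H × H)
    (J : K →ₗ⋆[ℂ] K) (hJi : ∀ x y, ⟪J x, J y⟫_ℂ = ⟪y, x⟫_ℂ) (hJJ : ∀ x, J (J x) = x)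
    (M : Submodule ℂ K) [CompleteSpace M] (hM : ∀ x, x ∈ M ↔ J x ∈ Mᗮ) :
    Nonempty (H ≃ₗᵢ[ℂ] M) := by
  by_cases hf : FiniteDimensional ℂ H
  · have : FiniteDimensional ℂ K := e.symm.finiteDimensional
    have h1 := aux_finrank_le J hJi M Mᗮ (fun x hx => (hM x).1 hx)
    have h2 := aux_finrank_le J hJi Mᗮ M (fun x hx => (hM _).2 (by rwa [hJJ]))
    have h3 := M.finrank_add_finrank_orthogonal
    have h4 := e.finrank_eq
    rw [Module.finrank_prod] at h4
    have h5 : Module.finrank ℂ H = Module.finrank ℂ M := by omega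
    exact ⟨(stdOrthonormalBasis ℂ H).equiv (stdOrthonormalBasis ℂ M) (finCongr h5)⟩
  · have hMf : ¬ FiniteDimensional ℂ M := by
      intro hMf
      apply hf
      have h1 : FiniteDimensional ℂ ↥(Mᗮ) := by
        let f : M →ₗ⋆[ℂ] ↥(Mᗮ) :=
          { toFun := fun x => ⟨J x, (hM x).1 x.2⟩
            map_add' := by intro x y; ext; simp
            map_smul' := by intro x y; ext; simp }
        refine Module.Finite.of_surjective f ?_
        rintro ⟨y, hy⟩
        exact ⟨⟨J y, (hM _).2 (by rwa [hJJ])⟩, Subtype.ext (hJJ y)⟩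
      have h2 : FiniteDimensional ℂ K := by
        have : FiniteDimensional ℂ ↥(M ⊔ Mᗮ) := inferInstance
        rw [Submodule.sup_orthogonal_of_hasOrthogonalProjection] at this
        exact (Submodule.topEquiv (R := ℂ) (M := K)).finiteDimensional
      have h3 : FiniteDimensional ℂ (H × H) := e.finiteDimensional
      exact Module.Finite.of_surjective (LinearMap.fst ℂ H H) LinearMap.fst_surjective
    obtain ⟨b⟩ := aux_basis hf
    obtain ⟨c⟩ := aux_basis hMf
    exact ⟨b.repr.trans c.repr.symm⟩

theorem aux_real_basis {K : Type*} [NormedAddCommGroup K] [InnerProductSpace ℂ K]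
    (J : K →ₗ⋆[ℂ] K) (hJi : ∀ x y, ⟪J x, J y⟫_ℂ = ⟪y, x⟫_ℂ) (hJJ : ∀ x, J (J x) = x)
    (Z : Submodule ℂ K) (hZ : ∀ x ∈ Z, J x ∈ Z) :
    ∃ S : Set K, S ⊆ {x | x ∈ Z ∧ J x = x} ∧ Orthonormal ℂ (fun x : S => (x : K)) ∧
      ∀ z ∈ Z, (∀ s ∈ S, ⟪s, z⟫_ℂ = 0) → z = 0 := by
  obtain ⟨S, hS⟩ := zorn_subset
    {S : Set K | S ⊆ {x | x ∈ Z ∧ J x = x} ∧ Orthonormal ℂ (fun x : S => (x : K))} (by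
      intro c hc hchain
      refine ⟨⋃₀ c, ⟨Set.sUnion_subset fun s hs => (hc hs).1, ?_⟩,
        fun s hs => Set.subset_sUnion_of_mem hs⟩
      exact orthonormal_sUnion_of_directed hchain.directedOn (fun a ha => (hc ha).2))
  refine ⟨S, hS.prop.1, hS.prop.2, ?_⟩
  have key : ∀ z ∈ Z, J z = z → (∀ s ∈ S, ⟪s, z⟫_ℂ = 0) → z = 0 := by
    intro z hz hJz hs
    by_contra hne
    have hn : ‖z‖ ≠ 0 := norm_ne_zero_iff.2 hne
    let w : K := ((‖z‖⁻¹ : ℝ) : ℂ) • z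
    have hw1 : ‖w‖ = 1 := by
      simp [w, norm_smul, hn]
    have hwS : ∀ s ∈ S, ⟪s, w⟫_ℂ = 0 := by
      intro s hs'; simp [w, hs s hs']
    have hJw : J w = w := by
      simp only [w, map_smulₛₗ, hJz, Complex.conj_ofReal]
    have hmem : insert w S ∈
      {S : Set K | S ⊆ {x | x ∈ Z ∧ J x = x} ∧ Orthonormal ℂ (fun x : S => (x : K))} := by
      refine ⟨Set.insert_subset ⟨Z.smul_mem _ hz, hJw⟩ hS.prop.1, ?_, ?_⟩
      · rintro ⟨x, hx | hx⟩
        · simpa [hx] using hw1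
        · exact hS.prop.2.1 ⟨x, hx⟩
      · rintro ⟨x, hx⟩ ⟨y, hy⟩ hxy
        have hxy' : x ≠ y := fun h => hxy (Subtype.ext h)
        rcases hx with hx | hx <;> rcases hy with hy | hy
        · exact absurd (hx.trans hy.symm) hxy'
        · subst hx; exact inner_eq_zero_symm.1 (hwS y hy)
        · subst hy; exact hwS x hx
        · exact hS.prop.2.2 (i := ⟨x, hx⟩) (j := ⟨y, hy⟩) (fun h => hxy' (congrArg Subtype.val h))
    have hwin : w ∈ S := hS.le_of_ge hmem (Set.subset_insert w S) (Set.mem_insert w S)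
    have := hwS w hwin
    rw [inner_self_eq_zero] at this
    rw [this] at hw1
    simp at hw1
  intro z hz hs
  have hsJ : ∀ s ∈ S, ⟪s, J z⟫_ℂ = 0 := by
    intro s hs'
    have h1 : J s = s := (hS.prop.1 hs').2
    rw [← h1, hJi]
    exact inner_eq_zero_symm.1 (hs s hs')
  have h1 := key (z + J z) (Z.add_mem hz (hZ z hz)) (by simp [hJJ, add_comm])
    (fun s hs' => by simp [hs s hs', hsJ s hs'])
  have h2 := key (Complex.I • (z - J z)) (Z.smul_mem _ (Z.sub_mem hz (hZ z hz)))
    (by simp [hJJ, ← smul_neg])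
    (fun s hs' => by simp [hs s hs', hsJ s hs'])
  rw [smul_eq_zero_iff_right Complex.I_ne_zero] at h2
  have h3 : (2 : ℂ) • z = 0 := by
    have : (2 : ℂ) • z = (z + J z) + (z - J z) := by module
    rw [this, h1, h2, add_zero]
  simpa using h3

theorem aux_kernel_split {K : Type*} [NormedAddCommGroup K] [InnerProductSpace ℂ K]
    (J : K →ₗ⋆[ℂ] K) (hJi : ∀ x y, ⟪J x, J y⟫_ℂ = ⟪y, x⟫_ℂ) (hJJ : ∀ x, J (J x) = x)
    (Z : Submodule ℂ K) (hZ : ∀ x ∈ Z, J x ∈ Z) (hev : Even (Module.finrank ℂ Z)) :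
    ∃ N : Set K, (∀ n ∈ N, n ∈ Z) ∧ (∀ n ∈ N, ∀ m ∈ N, ⟪n, J m⟫_ℂ = 0) ∧
      ∀ z ∈ Z, (∀ n ∈ N, ⟪n, z⟫_ℂ = 0) → (∀ n ∈ N, ⟪J n, z⟫_ℂ = 0) → z = 0 := by
  obtain ⟨S, hSZ, hSo, hSt⟩ := aux_real_basis J hJi hJJ Z hZ
  have hsplit : ∃ (T : Type _), Nonempty (T ⊕ T ≃ S) := by
    by_cases hfin : Finite S
    · have := Fintype.ofFinite S
      have hspan : Submodule.span ℂ (Set.range (fun x : S => (x : K))) = Z := by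
        apply le_antisymm
        · rw [Submodule.span_le]
          rintro _ ⟨x, rfl⟩
          exact (hSZ x.2).1
        · intro z hz
          set Y := Submodule.span ℂ (Set.range (fun x : S => (x : K))) with hY
          have hYZ : Y ≤ Z := by
            rw [hY, Submodule.span_le]
            rintro _ ⟨x, rfl⟩
            exact (hSZ x.2).1
          have : FiniteDimensional ℂ Y := FiniteDimensional.span_of_finite ℂ (Set.finite_range _)
          have hp := Y.starProjection_apply_mem z
          have h0 := hSt (z - Y.starProjection z) (Z.sub_mem hz (hYZ hp)) (by
            intro s hs
            exact inner_eq_zero_symm.1 (Submodule.starProjection_inner_eq_zero z s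
              (Submodule.subset_span ⟨⟨s, hs⟩, rfl⟩)))
          rw [sub_eq_zero] at h0
          rw [h0]; exact hp
      have hcard : Fintype.card S = Module.finrank ℂ Z := by
        rw [← hspan, finrank_span_eq_card hSo.linearIndependent]
      obtain ⟨n, hn⟩ := hev
      refine ⟨ULift (Fin n), ⟨Fintype.equivOfCardEq ?_⟩⟩
      simp [hcard, hn]
    · rw [not_finite_iff_infinite] at hfin
      refine ⟨S, ?_⟩
      rw [← Cardinal.eq]
      simp
  obtain ⟨T, ⟨e⟩⟩ := hsplit
  classical
  have hJe : ∀ i, J (e i : K) = e i := fun i => (hSZ (e i).2).2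
  have hJn : ∀ t, J ((e (Sum.inl t) : K) + Complex.I • (e (Sum.inr t) : K)) =
      (e (Sum.inl t) : K) - Complex.I • (e (Sum.inr t) : K) := by
    intro t
    simp [hJe, sub_eq_add_neg]
  have ho := hSo.comp e e.injective
  rw [orthonormal_iff_ite (𝕜 := ℂ)] at ho
  simp only [Function.comp] at ho
  refine ⟨Set.range fun t => (e (Sum.inl t) : K) + Complex.I • (e (Sum.inr t) : K), ?_, ?_, ?_⟩
  · rintro _ ⟨t, rfl⟩
    exact Z.add_mem (hSZ (e _).2).1 (Z.smul_mem _ (hSZ (e _).2).1)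
  · rintro _ ⟨t, rfl⟩ _ ⟨s, rfl⟩
    simp only [hJn, inner_add_left, inner_sub_right, inner_smul_left, inner_smul_right, ho]
    by_cases h : t = s <;> simp [h]
  · intro z hz h1 h2
    refine hSt z hz ?_
    intro s hs
    obtain ⟨i, hi⟩ := e.surjective ⟨s, hs⟩
    have hi' : s = e i := by rw [hi]
    rw [hi']
    have key : ∀ t, ⟪(e (Sum.inl t) : K), z⟫_ℂ = 0 ∧ ⟪(e (Sum.inr t) : K), z⟫_ℂ = 0 := by
      intro t
      have a1 := h1 _ ⟨t, rfl⟩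
      have a2 := h2 _ ⟨t, rfl⟩
      simp only [hJn, inner_add_left, inner_sub_left, inner_smul_left] at a1 a2
      constructor
      · linear_combination (a1 + a2) / 2
      · have : (starRingEnd ℂ) Complex.I * ⟪(e (Sum.inr t) : K), z⟫_ℂ = 0 := by
          linear_combination (a1 - a2) / 2
        simpa using this
    rcases i with t | t
    · exact (key t).1
    · exact (key t).2

open ComplexOrder in
theorem aux_half {K : Type*} [NormedAddCommGroup K] [InnerProductSpace ℂ K] [CompleteSpace K]
    (J : K →ₗ⋆[ℂ] K) (hJi : ∀ x y, ⟪J x, J y⟫_ℂ = ⟪y, x⟫_ℂ) (hJJ : ∀ x, J (J x) = x)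
    (B : K →L[ℂ] K) (hB : IsSelfAdjoint B) (hJB : ∀ x, J (B (J x)) = - B x)
    (hev : Even (Module.finrank ℂ (LinearMap.ker (B : K →ₗ[ℂ] K)))) :
    ∃ M : Submodule ℂ K, IsClosed (M : Set K) ∧ (∀ x, x ∈ M ↔ J x ∈ Mᗮ) ∧
      (∀ x ∈ M, B x ∈ M) ∧ ∀ x ∈ M, 0 ≤ ⟪B x, x⟫_ℂ := by
  have hBJ : ∀ x, B (J x) = - J (B x) := by
    intro x
    have := hJB (J x)
    rw [hJJ] at this
    rw [this, neg_neg]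
  -- positive and negative part
  obtain ⟨P, Q, hP, hQ, hPQ, hQP, hBPQ, hJP⟩ : ∃ P Q : K →L[ℂ] K, P.IsPositive ∧ Q.IsPositive ∧
      P * Q = 0 ∧ Q * P = 0 ∧ B = P - Q ∧ ∀ x, J (P (J x)) = Q x := by
    have hP := (ContinuousLinearMap.nonneg_iff_isPositive _).1 (CFC.posPart_nonneg B)
    have hQ := (ContinuousLinearMap.nonneg_iff_isPositive _).1 (CFC.negPart_nonneg B)
    have hsub := CFC.posPart_sub_negPart B hB
    have hmul := CFC.posPart_mul_negPart B
    refine ⟨B⁺, B⁻, hP, hQ, hmul, CFC.negPart_mul_posPart B, hsub.symm, ?_⟩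
    have hJn : ∀ x, ‖J x‖ ≤ 1 * ‖x‖ := by
      intro x
      rw [one_mul, @norm_eq_sqrt_re_inner ℂ, @norm_eq_sqrt_re_inner ℂ _ _ _ _ x, hJi]
    let Jc : K →L⋆[ℂ] K := J.mkContinuous 1 hJn
    have hJc : ∀ x, Jc x = J x := fun x => rfl
    have hpos : ∀ R : K →L[ℂ] K, R.IsPositive →
        ((Jc.comp (R.comp Jc) : K →L[ℂ] K)).IsPositive := by
      intro R hR
      rw [ContinuousLinearMap.isPositive_iff]
      constructor
      · intro x y
        change ⟪J (R (J x)), y⟫_ℂ = ⟪x, J (R (J y))⟫_ℂ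
        calc ⟪J (R (J x)), y⟫_ℂ = ⟪J (R (J x)), J (J y)⟫_ℂ := by rw [hJJ]
          _ = ⟪J y, R (J x)⟫_ℂ := hJi _ _
          _ = ⟪R (J y), J x⟫_ℂ := (hR.isSymmetric _ _).symm
          _ = ⟪J (J x), J (R (J y))⟫_ℂ := (hJi _ _).symm
          _ = _ := by rw [hJJ]
      · intro x
        change 0 ≤ ⟪J (R (J x)), x⟫_ℂ
        have : ⟪J (R (J x)), x⟫_ℂ = ⟪J x, R (J x)⟫_ℂ := by
          conv_lhs => rw [← hJJ x, hJi]
          rw [hJJ]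
        rw [this]
        exact hR.inner_nonneg_right _
    have hu := CFC.posPart_negPart_unique (a := B)
      (b := (Jc.comp (B⁻.comp Jc) : K →L[ℂ] K)) (c := (Jc.comp (B⁺.comp Jc) : K →L[ℂ] K))
      (by
        ext x
        have h1 : B (J x) = B⁺ (J x) - B⁻ (J x) := by
          conv_lhs => rw [← hsub]
          rfl
        have h2 := hJB x
        rw [h1, map_sub] at h2
        change B x = J (B⁻ (J x)) - J (B⁺ (J x))
        rw [← neg_sub, h2, neg_neg])
      (by
        ext x
        change J (B⁻ (J (J (B⁺ (J x))))) = 0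
        rw [hJJ]
        have : B⁻ (B⁺ (J x)) = 0 := by
          rw [← mul_apply_eq_comp, CFC.negPart_mul_posPart B]; rfl
        rw [this, map_zero])
      ((ContinuousLinearMap.nonneg_iff_isPositive _).2 (hpos _ hQ))
      ((ContinuousLinearMap.nonneg_iff_isPositive _).2 (hpos _ hP))
    intro x
    exact (congrArg (fun T : K →L[ℂ] K => T x) hu.2).symm
  have hPQx : ∀ x, P (Q x) = 0 := fun x => congrArg (fun T : K →L[ℂ] K => T x) hPQ
  have hQPx : ∀ x, Q (P x) = 0 := fun x => congrArg (fun T : K →L[ℂ] K => T x) hQP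
  have hBx : ∀ x, B x = P x - Q x := fun x => by rw [hBPQ]; rfl
  have hPJ : ∀ x, P (J x) = J (Q x) := fun x => by rw [← hJP, hJJ]
  have hPs : ∀ x y, ⟪P x, y⟫_ℂ = ⟪x, P y⟫_ℂ := hP.isSymmetric
  have hQs : ∀ x y, ⟪Q x, y⟫_ℂ = ⟪x, Q y⟫_ℂ := hQ.isSymmetric
  have hBs : ∀ x y, ⟪B x, y⟫_ℂ = ⟪x, B y⟫_ℂ := by
    intro x y; simp only [hBx, inner_sub_left, inner_sub_right, hPs, hQs]
  have hQ0 : ∀ x, B x = 0 → Q x = 0 := by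
    intro x hx
    rw [← inner_self_eq_zero (𝕜 := ℂ), hQs]
    have : Q (Q x) = 0 := by
      have h1 : Q x = P x := by rw [hBx, sub_eq_zero] at hx; exact hx.symm
      rw [h1, hQPx]
    rw [this, inner_zero_right]
  obtain ⟨N, hNZ, hNJ, hNt⟩ := aux_kernel_split J hJi hJJ (LinearMap.ker (B : K →ₗ[ℂ] K))
    (by
      intro x hx
      have hx' : B x = 0 := hx
      change B (J x) = 0
      rw [hBJ, hx', map_zero, neg_zero]) hev
  have hNB : ∀ n ∈ N, B n = 0 := hNZ
  let L : Submodule ℂ K := LinearMap.ker (P : K →ₗ[ℂ] K) ⊓ (Submodule.span ℂ N)ᗮ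
  have hL : ∀ x, x ∈ L ↔ P x = 0 ∧ ∀ n ∈ N, ⟪n, x⟫_ℂ = 0 := by
    intro x
    refine (Submodule.mem_inf).trans (and_congr Iff.rfl ?_)
    rw [Submodule.mem_orthogonal]
    constructor
    · intro h n hn; exact h n (Submodule.subset_span hn)
    · intro h u hu
      induction hu using Submodule.span_induction with
      | mem u hu => exact h u hu
      | zero => simp
      | add u v _ _ h1 h2 => simp [inner_add_left, h1, h2]
      | smul a u _ h1 => simp [inner_smul_left, h1]
  have hLc : IsClosed (L : Set K) := by
    have h1 : IsClosed ((LinearMap.ker (P : K →ₗ[ℂ] K) : Submodule ℂ K) : Set K) := P.isClosed_ker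
    exact h1.inter (Submodule.isClosed_orthogonal _)
  have : CompleteSpace L := hLc.completeSpace_coe
  have hfwd : ∀ x, x ∈ Lᗮ → Q x = 0 ∧ J x ∈ L := by
    intro x hx
    rw [Submodule.mem_orthogonal] at hx
    have hQx : Q x = 0 := by
      rw [← inner_self_eq_zero (𝕜 := ℂ), ← hQs]
      refine hx _ ((hL _).2 ⟨hPQx _, ?_⟩)
      intro n hn
      rw [← hQs, hQ0 n (hNB n hn), inner_zero_left]
    refine ⟨hQx, (hL _).2 ⟨by rw [hPJ, hQx, map_zero], ?_⟩⟩
    intro n hn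
    rw [← hJJ n, hJi, inner_eq_zero_symm]
    refine hx _ ((hL _).2 ⟨by rw [hPJ, hQ0 n (hNB n hn), map_zero], fun m hm => hNJ m hm n hn⟩)
  have hdis : ∀ v, v ∈ L → J v ∈ L → v = 0 := by
    intro v h1 h2
    rw [hL] at h1 h2
    have hQv : Q v = 0 := by
      rw [← hJJ (Q v), ← hPJ, h2.1, map_zero]
    refine hNt v ?_ h1.2 ?_
    · change B v = 0
      rw [hBx, h1.1, hQv, sub_zero]
    · intro n hn
      rw [← hJJ v, hJi, inner_eq_zero_symm]
      exact h2.2 n hn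
  refine ⟨Lᗮ, Submodule.isClosed_orthogonal _, ?_, ?_, ?_⟩
  · intro x
    rw [Submodule.orthogonal_orthogonal]
    refine ⟨fun h => (hfwd x h).2, fun h => ?_⟩
    have hw := L.sub_starProjection_mem_orthogonal x
    have hv := L.starProjection_apply_mem x
    have hJv : J (L.starProjection x) ∈ L := by
      have := L.sub_mem h (hfwd _ hw).2
      rwa [← map_sub, sub_sub_cancel] at this
    have := hdis _ hv hJv
    rwa [this, sub_zero] at hw
  · intro x hx
    rw [Submodule.mem_orthogonal] at hx ⊢
    intro y hy
    rw [← hBs]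
    rw [hL] at hy
    refine hx _ ((hL _).2 ⟨?_, ?_⟩)
    · rw [hBx, map_sub, hPQx, hy.1, map_zero, sub_zero]
    · intro n hn
      rw [← hBs, hNB n hn, inner_zero_left]
  · intro x hx
    rw [hBx, (hfwd x hx).1, sub_zero]
    exact hP.inner_nonneg_left x

/-- diagonalization of fermionic block operators.  Let `H` be a
separable complex Hilbert space with a conjugation `C`, `K = H ⊕ H`, and
`𝒥(f,g) = (Cg, Cf)`.  If `B` is a bounded self-adjoint operator on `K` with
`𝒥B𝒥 = −B` and `dim Ker(B)` even (possibly `0`) or infinite, then there is a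
unitary `𝒰` on `K` commuting with `𝒥` and a bounded positive operator `ξ` on `H`
with `𝒰 B 𝒰* = [[ξ, 0], [0, −CξC]]` in block form; moreover `ξ` can be chosen
injective when `B` is. -/
theorem fermionic_block_diagonalization_hilbert
    {H : Type*} [NormedAddCommGroup H] [InnerProductSpace ℂ H] [CompleteSpace H]
    [TopologicalSpace.SeparableSpace H]
    -- the conjugation C
    (C : H → H)
    (hC_add : ∀ f g, C (f + g) = C f + C g)
    (hC_smul : ∀ (a : ℂ) (f : H), C (a • f) = (starRingEnd ℂ a) • C f)
    (hC_inner : ∀ f g : H, ⟪C f, C g⟫_ℂ = ⟪g, f⟫_ℂ)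
    (hC_invol : ∀ f, C (C f) = f)
    -- the operator B
    (B : DirectSum2 H →L[ℂ] DirectSum2 H)
    (hB_sa : IsSelfAdjoint B)
    (hJBJ : ∀ x, Jmap C (B (Jmap C x)) = -(B x))
    -- dim Ker(B) is even (possibly 0) or infinite
    (hker : Even (Module.finrank ℂ (LinearMap.ker (B : DirectSum2 H →ₗ[ℂ] DirectSum2 H)))) :
    ∃ (𝒰 : DirectSum2 H →L[ℂ] DirectSum2 H) (ξ : H →L[ℂ] H),
      -- 𝒰 is unitary
      ContinuousLinearMap.adjoint 𝒰 * 𝒰 = 1 ∧ 𝒰 * ContinuousLinearMap.adjoint 𝒰 = 1 ∧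
      -- 𝒥 𝒰 𝒥 = 𝒰
      (∀ x, Jmap C (𝒰 (Jmap C x)) = 𝒰 x) ∧
      -- ξ is bounded self-adjoint positive semidefinite
      ξ.IsPositive ∧
      -- 𝒰 B 𝒰* = [[ξ, 0], [0, −CξC]]
      (∀ f g : H, (𝒰 * B * ContinuousLinearMap.adjoint 𝒰) (pairK f g) =
        pairK (ξ f) (-(C (ξ (C g))))) ∧
      -- if Ker(B) = {0} then ξ can be chosen with Ker(ξ) = {0}
      (LinearMap.ker (B : DirectSum2 H →ₗ[ℂ] DirectSum2 H) = ⊥ →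
        LinearMap.ker (ξ : H →ₗ[ℂ] H) = ⊥) := by
  -- the antilinear involution on `K`
  let J : DirectSum2 H →ₗ⋆[ℂ] DirectSum2 H :=
    { toFun := Jmap C
      map_add' := by
        intro x y
        change pairK (C (sndK x + sndK y)) (C (fstK x + fstK y)) = _
        rw [hC_add, hC_add]; rfl
      map_smul' := by
        intro a x
        change pairK (C (a • sndK x)) (C (a • fstK x)) = _
        rw [hC_smul, hC_smul]; rfl }
  have hJ : ∀ x, J x = Jmap C x := fun x => rfl
  have hin : ∀ x y : DirectSum2 H,
      ⟪x, y⟫_ℂ = ⟪fstK x, fstK y⟫_ℂ + ⟪sndK x, sndK y⟫_ℂ := fun x y => rfl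
  have hJi : ∀ x y, ⟪J x, J y⟫_ℂ = ⟪y, x⟫_ℂ := by
    intro x y
    rw [hin, hin, add_comm]
    exact congrArg₂ (· + ·) (hC_inner _ _) (hC_inner _ _)
  have hJJ : ∀ x, J (J x) = x := by
    intro x
    change pairK (C (C (fstK x))) (C (C (sndK x))) = x
    rw [hC_invol, hC_invol]; rfl
  have hBJ : ∀ x, B (J x) = - J (B x) := by
    intro x
    have : J (B (J (J x))) = - B (J x) := hJBJ (J x)
    rw [hJJ] at this
    rw [this, neg_neg]
  have hBs : ∀ x y, ⟪B x, y⟫_ℂ = ⟪x, B y⟫_ℂ := hB_sa.isSymmetric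
  obtain ⟨M, hMc, hMJ, hMB, hMpos⟩ := aux_half J hJi hJJ B hB_sa hJBJ hker
  have hMcs : CompleteSpace M := hMc.completeSpace_coe
  have hsep : TopologicalSpace.SeparableSpace (DirectSum2 H) :=
    (WithLp.homeomorphProd 2 H H).symm.surjective.denseRange.separableSpace
      (WithLp.homeomorphProd 2 H H).symm.continuous
  obtain ⟨u⟩ := aux_iso (WithLp.linearEquiv 2 ℂ (H × H)) J hJi hJJ M hMJ
  have hC_neg : ∀ f, C (-f) = - C f := by
    intro f
    have := hC_smul (-1) f
    simpa using this
  have horth : ∀ f g, ⟪(u f : DirectSum2 H), J (u g)⟫_ℂ = 0 := by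
    intro f g
    exact ((hMJ _).1 (u g).2) _ (u f).2
  let V0 : DirectSum2 H →ₗ[ℂ] DirectSum2 H :=
    { toFun := fun x => (u (fstK x) : DirectSum2 H) + J (u (C (sndK x)))
      map_add' := by
        intro x y
        change (u (fstK x + fstK y) : DirectSum2 H) + J (u (C (sndK x + sndK y))) = _
        simp only [hC_add, map_add, Submodule.coe_add]
        abel
      map_smul' := by
        intro a x
        change (u (a • fstK x) : DirectSum2 H) + J (u (C (a • sndK x))) = _
        simp [hC_smul, map_smulₛₗ] }
  have hV0 : ∀ f g, V0 (pairK f g) = (u f : DirectSum2 H) + J (u (C g)) := fun f g => rfl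
  let V1 : DirectSum2 H →ₗᵢ[ℂ] DirectSum2 H := V0.isometryOfInner (by
    intro x y
    change ⟪(u (fstK x) : DirectSum2 H) + J (u (C (sndK x))),
      (u (fstK y) : DirectSum2 H) + J (u (C (sndK y)))⟫_ℂ = _
    have h2 : ⟪J (u (C (sndK x))), (u (fstK y) : DirectSum2 H)⟫_ℂ = 0 :=
      inner_eq_zero_symm.1 (horth _ _)
    have h3 : ∀ f g, ⟪(u f : DirectSum2 H), (u g : DirectSum2 H)⟫_ℂ = ⟪f, g⟫_ℂ :=
      fun f g => u.inner_map_map f g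
    rw [inner_add_left, inner_add_right, inner_add_right, horth, h2, hJi, h3, h3, hC_inner, hin]
    ring)
  have hsurj : Function.Surjective V1 := by
    intro z
    have h1 := M.starProjection_apply_mem z
    have h2 := M.sub_starProjection_mem_orthogonal z
    have h3 : J (z - M.starProjection z) ∈ M := (hMJ _).2 (by rwa [hJJ])
    refine ⟨pairK (u.symm ⟨_, h1⟩) (C (u.symm ⟨_, h3⟩)), ?_⟩
    change V0 _ = z
    rw [hV0, hC_invol, u.apply_symm_apply, u.apply_symm_apply]
    change M.starProjection z + J (J (z - M.starProjection z)) = z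
    rw [hJJ]; abel
  let V : DirectSum2 H ≃ₗᵢ[ℂ] DirectSum2 H := LinearIsometryEquiv.ofSurjective V1 hsurj
  have hV : ∀ f g, V (pairK f g) = (u f : DirectSum2 H) + J (u (C g)) := fun f g => rfl
  let U : DirectSum2 H →L[ℂ] DirectSum2 H := V.symm.toContinuousLinearEquiv
  let Vc : DirectSum2 H →L[ℂ] DirectSum2 H := V.toContinuousLinearEquiv
  have hadj : ContinuousLinearMap.adjoint U = Vc := by
    symm
    rw [ContinuousLinearMap.eq_adjoint_iff]
    intro x y
    change ⟪V x, y⟫_ℂ = ⟪x, V.symm y⟫_ℂ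
    rw [← V.inner_map_map x, V.apply_symm_apply]
  let R : M →L[ℂ] M := (B.comp M.subtypeL).codRestrict M (fun x => hMB _ x.2)
  let ξ : H →L[ℂ] H :=
    (u.symm.toContinuousLinearEquiv : M →L[ℂ] H).comp
      (R.comp (u.toContinuousLinearEquiv : H →L[ℂ] M))
  have hξ : ∀ f, (u (ξ f) : DirectSum2 H) = B (u f) := by
    intro f
    change (u (u.symm (R (u f))) : DirectSum2 H) = _
    rw [u.apply_symm_apply]; rfl
  have hui : ∀ f g, ⟪f, g⟫_ℂ = ⟪(u f : DirectSum2 H), (u g : DirectSum2 H)⟫_ℂ :=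
      fun f g => (u.inner_map_map f g).symm
  refine ⟨U, ξ, ?_, ?_, ?_, ?_, ?_, ?_⟩
  · rw [hadj]; ext1 x; exact V.apply_symm_apply x
  · rw [hadj]; ext1 x; exact V.symm_apply_apply x
  · intro x
    change J (V.symm (J x)) = V.symm x
    have hVJ : ∀ y, V (J y) = J (V y) := by
      intro y
      change (u (C (sndK y)) : DirectSum2 H) + J (u (C (C (fstK y)))) =
        J ((u (fstK y) : DirectSum2 H) + J (u (C (sndK y))))
      rw [hC_invol, map_add, hJJ, add_comm]
    apply V.injective
    rw [hVJ, V.apply_symm_apply, V.apply_symm_apply, hJJ]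
  · rw [ContinuousLinearMap.isPositive_iff]
    constructor
    · intro f g
      change ⟪ξ f, g⟫_ℂ = ⟪f, ξ g⟫_ℂ
      rw [hui, hui, hξ, hξ, hBs]
    · intro f
      rw [hui, hξ]
      exact hMpos _ (u f).2
  · intro f g
    rw [hadj]
    change V.symm (B (V (pairK f g))) = _
    rw [V.symm_apply_eq, hV, hV, map_add, hBJ, hC_neg, hC_invol, map_neg, Submodule.coe_neg,
      map_neg, hξ, hξ]
  · intro hk
    rw [LinearMap.ker_eq_bot'] at hk ⊢
    intro f hf
    have hf' : ξ f = 0 := hf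
    have h1 : B (u f : DirectSum2 H) = 0 := by rw [← hξ, hf']; simp
    have h2 := hk _ h1
    have h3 : u f = 0 := Subtype.ext h2
    simpa using h3

end
end

section
/- Let H be a complex Hilbert space with a conjugation C, K := H ⊕ H, S the bounded operator on K given in block form by S = [[1, 0], [0, −1]], and 𝒥 : K → K the anti-unitary involution 𝒥(f, g) := (Cg, Cf). Let 𝒜 be a bounded self-adjoint operator on K with 𝒥 𝒜 𝒥 = 𝒜 and 𝒜 ≥ μ for some constant μ > 0 (i.e. ⟨x, 𝒜x⟩ ≥ μ‖x‖² for all x ∈ K). Define B := 𝒜^{1/2} S 𝒜^{1/2}. Then: (a) B is bounded, self-adjoint, invertible, and 𝒥 B 𝒥 = −B; (b) if 𝒰 is any unitary operator on K with 𝒥 𝒰 𝒥 = 𝒰 such that 𝒰 B 𝒰* = [[ξ, 0], [0, −C ξ C]] in block form for some bounded self-adjoint positive semidefinite ξ on H, then the bounded operator 𝒱 := 𝒰 |B|^{1/2} 𝒜^{−1/2}, where |B| := (B²)^{1/2}, is invertible and satisfies 𝒥 𝒱 𝒥 = 𝒱, 𝒱* S 𝒱 = S = 𝒱 S 𝒱*,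 and 𝒱 𝒜 𝒱* = [[ξ, 0], [0, C ξ C]]. -/
open scoped InnerProductSpace

noncomputable section

variable {H : Type*} [NormedAddCommGroup H] [InnerProductSpace ℂ H]

theorem pos_sq_unique {E : Type*} [NormedAddCommGroup E] [InnerProductSpace ℂ E] [CompleteSpace E]
    {X Y : E →L[ℂ] E} (hX : X.IsPositive) (hY : Y.IsPositive) (h : X * X = Y * Y) : X = Y := by
  have hX' := (ContinuousLinearMap.nonneg_iff_isPositive X).2 hX
  have hY' := (ContinuousLinearMap.nonneg_iff_isPositive Y).2 hY
  rw [← CFC.sqrt_mul_self X hX', h, CFC.sqrt_mul_self Y hY']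

theorem inner_pairK (a b c d : H) :
    ⟪pairK a b, pairK c d⟫_ℂ = ⟪a, c⟫_ℂ + ⟪b, d⟫_ℂ := by
  simp [pairK, WithLp.prod_inner_apply]

theorem pairK_eta (x : DirectSum2 H) : pairK (fstK x) (sndK x) = x := rfl

theorem pairK_add (a b c d : H) : pairK a b + pairK c d = pairK (a + c) (b + d) := rfl

theorem pairK_smul (z : ℂ) (a b : H) : z • pairK a b = pairK (z • a) (z • b) := rfl

theorem pairK_neg (a b : H) : - pairK a b = pairK (-a) (-b) := rfl

theorem Jmap_pairK (C : H → H) (a b : H) : Jmap C (pairK a b) = pairK (C b) (C a) := rfl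

/-- Conjugation of a bounded operator by a conjugation. -/
theorem exists_conj {E : Type*} [NormedAddCommGroup E] [InnerProductSpace ℂ E] [CompleteSpace E]
    (J : E → E) (hadd : ∀ f g, J (f + g) = J f + J g)
    (hsmul : ∀ (a : ℂ) (f : E), J (a • f) = (starRingEnd ℂ a) • J f)
    (hinner : ∀ f g : E, ⟪J f, J g⟫_ℂ = ⟪g, f⟫_ℂ)
    (hinvol : ∀ f, J (J f) = f) (T : E →L[ℂ] E) :
    ∃ T' : E →L[ℂ] E, (∀ x, T' x = J (T (J x))) ∧ (T.IsPositive → T'.IsPositive) := by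
  have hnorm : ∀ x, ‖J x‖ = ‖x‖ := by
    intro x
    rw [@norm_eq_sqrt_re_inner ℂ, @norm_eq_sqrt_re_inner ℂ _ _ _ _ x, hinner]
  let L : E →ₗ[ℂ] E :=
    { toFun := fun x => J (T (J x))
      map_add' := fun x y => by simp [hadd]
      map_smul' := fun a x => by simp [hsmul] }
  refine ⟨L.mkContinuous ‖T‖ (fun x => ?_), fun x => rfl, fun hT => ?_⟩
  · change ‖J (T (J x))‖ ≤ _
    rw [hnorm]
    simpa [hnorm] using T.le_opNorm (J x)
  · rw [ContinuousLinearMap.isPositive_iff_complex] at hT ⊢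
    intro x
    have : ⟪L.mkContinuous ‖T‖ (fun x => by
        change ‖J (T (J x))‖ ≤ _
        rw [hnorm]
        simpa [hnorm] using T.le_opNorm (J x)) x, x⟫_ℂ = ⟪J x, T (J x)⟫_ℂ := by
      change ⟪J (T (J x)), x⟫_ℂ = _
      conv_lhs => rw [← hinvol x, hinner, hinvol]
    rw [this]
    obtain ⟨h1, h2⟩ := hT (J x)
    rw [← inner_conj_symm, ← h1]
    simpa using h2

theorem pos_sqrt_comm {E : Type*} [NormedAddCommGroup E] [InnerProductSpace ℂ E] [CompleteSpace E]
    (J : E → E) (hadd : ∀ f g, J (f + g) = J f + J g)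
    (hsmul : ∀ (a : ℂ) (f : E), J (a • f) = (starRingEnd ℂ a) • J f)
    (hinner : ∀ f g : E, ⟪J f, J g⟫_ℂ = ⟪g, f⟫_ℂ)
    (hinvol : ∀ f, J (J f) = f) (T : E →L[ℂ] E) (hT : T.IsPositive)
    (h : ∀ x, J ((T * T) (J x)) = (T * T) x) (x : E) : J (T (J x)) = T x := by
  obtain ⟨T', h1, h2⟩ := exists_conj J hadd hsmul hinner hinvol T
  rw [← h1]
  congr 1
  refine pos_sq_unique (h2 hT) hT ?_
  ext y
  rw [← h]
  simp [h1, hinvol]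

/-- construction of the diagonalizing Bogoliubov transformation.
Let `H` be a complex Hilbert space with a conjugation `C`, `K = H ⊕ H`,
`S = [[1,0],[0,−1]]` and `𝒥(f,g) = (Cg, Cf)`.  Let `𝒜` be bounded self-adjoint
with `𝒥𝒜𝒥 = 𝒜` and `𝒜 ≥ μ > 0`, and let `B = 𝒜^{1/2} S 𝒜^{1/2}`.  Then (a) `B`
is self-adjoint, invertible, and `𝒥B𝒥 = −B`; and (b) if a unitary `𝒰` commuting
with `𝒥` satisfies `𝒰 B 𝒰* = [[ξ,0],[0,−CξC]]` with `ξ` positive, then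
`𝒱 = 𝒰 |B|^{1/2} 𝒜^{−1/2}` is an invertible Bogoliubov transformation with
`𝒥𝒱𝒥 = 𝒱`, `𝒱* S 𝒱 = S = 𝒱 S 𝒱*` and `𝒱 𝒜 𝒱* = [[ξ,0],[0,CξC]]`.
Here `𝒜^{1/2}` is encoded as the (unique) positive operator `R` with `R² = 𝒜`,
`𝒜^{−1/2}` as its two-sided inverse `Rinv`, `|B|` as the positive operator
`absB` with `absB² = B²`, and `|B|^{1/2}` as the positive operator `P` with
`P² = absB`. -/
theorem bogoliubov_transformation_construction
    {H : Type*} [NormedAddCommGroup H] [InnerProductSpace ℂ H] [CompleteSpace H]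
    -- the conjugation C
    (C : H → H)
    (hC_add : ∀ f g, C (f + g) = C f + C g)
    (hC_smul : ∀ (a : ℂ) (f : H), C (a • f) = (starRingEnd ℂ a) • C f)
    (hC_inner : ∀ f g : H, ⟪C f, C g⟫_ℂ = ⟪g, f⟫_ℂ)
    (hC_invol : ∀ f, C (C f) = f)
    -- the operator S = [[1, 0], [0, -1]]
    (S : DirectSum2 H →L[ℂ] DirectSum2 H)
    (hS : ∀ f g : H, S (pairK f g) = pairK f (-g))
    -- the operator 𝒜, bounded self-adjoint, 𝒥𝒜𝒥 = 𝒜, 𝒜 ≥ μ > 0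
    (𝒜 : DirectSum2 H →L[ℂ] DirectSum2 H)
    (h𝒜_sa : IsSelfAdjoint 𝒜)
    (hJAJ : ∀ x, Jmap C (𝒜 (Jmap C x)) = 𝒜 x)
    (μ : ℝ) (hμ : 0 < μ)
    (h𝒜_coercive : ∀ x : DirectSum2 H, μ * ‖x‖ ^ 2 ≤ (⟪x, 𝒜 x⟫_ℂ).re)
    -- R = 𝒜^{1/2} and Rinv = 𝒜^{-1/2}
    (R : DirectSum2 H →L[ℂ] DirectSum2 H)
    (hR_pos : R.IsPositive) (hR_sq : R * R = 𝒜)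
    (Rinv : DirectSum2 H →L[ℂ] DirectSum2 H)
    (hRinv₁ : R * Rinv = 1) (hRinv₂ : Rinv * R = 1)
    -- B = 𝒜^{1/2} S 𝒜^{1/2}
    (B : DirectSum2 H →L[ℂ] DirectSum2 H) (hB : B = R * S * R) :
    -- (a)
    (IsSelfAdjoint B ∧ IsUnit B ∧ ∀ x, Jmap C (B (Jmap C x)) = -(B x)) ∧
    -- (b)
    (∀ (𝒰 : DirectSum2 H →L[ℂ] DirectSum2 H) (ξ : H →L[ℂ] H)
      (absB P : DirectSum2 H →L[ℂ] DirectSum2 H),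
      -- 𝒰 is unitary and commutes with 𝒥
      ContinuousLinearMap.adjoint 𝒰 * 𝒰 = 1 → 𝒰 * ContinuousLinearMap.adjoint 𝒰 = 1 →
      (∀ x, Jmap C (𝒰 (Jmap C x)) = 𝒰 x) →
      -- ξ is bounded self-adjoint positive semidefinite
      ξ.IsPositive →
      -- 𝒰 B 𝒰* = [[ξ, 0], [0, −CξC]]
      (∀ f g : H, (𝒰 * B * ContinuousLinearMap.adjoint 𝒰) (pairK f g) =
        pairK (ξ f) (-(C (ξ (C g))))) →
      -- |B| = (B²)^{1/2} and P = |B|^{1/2}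
      absB.IsPositive → absB * absB = B * B →
      P.IsPositive → P * P = absB →
      -- conclusions about 𝒱 = 𝒰 |B|^{1/2} 𝒜^{-1/2}
      (let 𝒱 : DirectSum2 H →L[ℂ] DirectSum2 H := 𝒰 * P * Rinv
       IsUnit 𝒱 ∧
       (∀ x, Jmap C (𝒱 (Jmap C x)) = 𝒱 x) ∧
       ContinuousLinearMap.adjoint 𝒱 * S * 𝒱 = S ∧
       𝒱 * S * ContinuousLinearMap.adjoint 𝒱 = S ∧
       (∀ f g : H, (𝒱 * 𝒜 * ContinuousLinearMap.adjoint 𝒱) (pairK f g) =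
         pairK (ξ f) (C (ξ (C g)))))) := by
  have J_add : ∀ x y, Jmap C (x + y) = Jmap C x + Jmap C y := by
    intro x y
    rw [← pairK_eta x, ← pairK_eta y, pairK_add]
    simp only [Jmap_pairK, pairK_add, hC_add]
  have J_smul : ∀ (a : ℂ) x, Jmap C (a • x) = (starRingEnd ℂ a) • Jmap C x := by
    intro a x
    rw [← pairK_eta x, pairK_smul]
    simp only [Jmap_pairK, pairK_smul, hC_smul]
  have J_inner : ∀ x y, ⟪Jmap C x, Jmap C y⟫_ℂ = ⟪y, x⟫_ℂ := by
    intro x y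
    rw [← pairK_eta x, ← pairK_eta y]
    simp only [Jmap_pairK, inner_pairK, hC_inner]
    ring
  have J_invol : ∀ x, Jmap C (Jmap C x) = x := by
    intro x
    rw [← pairK_eta x]
    simp only [Jmap_pairK, hC_invol]
  have C_neg : ∀ f, C (-f) = - C f := by
    intro f
    have := hC_smul (-1) f
    simpa using this
  have J_neg : ∀ x, Jmap C (-x) = - Jmap C x := by
    intro x
    have := J_smul (-1) x
    simpa using this
  have S_sa : IsSelfAdjoint S := by
    rw [ContinuousLinearMap.isSelfAdjoint_iff_isSymmetric]
    intro x y
    change ⟪S x, y⟫_ℂ = ⟪x, S y⟫_ℂ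
    rw [← pairK_eta x, ← pairK_eta y]
    simp only [hS, inner_pairK]
    simp
  have S_sq : S * S = 1 := by
    ext1 x
    change S (S x) = x
    rw [← pairK_eta x]
    simp only [hS, neg_neg]
  have S_J : ∀ x, S (Jmap C x) = - Jmap C (S x) := by
    intro x
    rw [← pairK_eta x]
    simp only [hS, Jmap_pairK, pairK_neg, C_neg, neg_neg]
  -- commutation form
  have comm : ∀ T : DirectSum2 H →L[ℂ] DirectSum2 H, (∀ x, Jmap C (T (Jmap C x)) = T x) →
      ∀ x, T (Jmap C x) = Jmap C (T x) := by
    intro T h x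
    rw [← h x, J_invol]
  have R_J : ∀ x, R (Jmap C x) = Jmap C (R x) :=
    comm R (pos_sqrt_comm (Jmap C) J_add J_smul J_inner J_invol R hR_pos (by rw [hR_sq]; exact hJAJ))
  have Rinv_J : ∀ x, Rinv (Jmap C x) = Jmap C (Rinv x) := by
    intro x
    have h1 : ∀ y, R (Rinv y) = y := fun y => by
      simpa using congrArg (fun T => T y) hRinv₁
    have h2 : ∀ y, Rinv (R y) = y := fun y => by
      simpa using congrArg (fun T => T y) hRinv₂
    rw [← h2 (Jmap C (Rinv x)), R_J, h1]
  have B_J : ∀ x, B (Jmap C x) = - Jmap C (B x) := by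
    intro x
    subst hB
    simp [R_J, S_J]
  have R_sa : star R = R := hR_pos.isSelfAdjoint
  have S_sa' : star S = S := S_sa
  have Rinv_sa : star Rinv = Rinv := by
    have h : star Rinv * R = 1 := by
      have := congrArg star hRinv₁
      simpa [R_sa] using this
    calc star Rinv = star Rinv * (R * Rinv) := by rw [hRinv₁, mul_one]
      _ = Rinv := by rw [← mul_assoc, h, one_mul]
  have B_sa : star B = B := by rw [hB]; simp [R_sa, S_sa', mul_assoc]
  have XB : (Rinv * S * Rinv) * B = 1 := by
    calc (Rinv * S * Rinv) * B = Rinv * S * (Rinv * R) * S * R := by rw [hB]; simp only [mul_assoc]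
      _ = Rinv * (S * S) * R := by rw [hRinv₂]; simp only [mul_assoc, mul_one, one_mul]
      _ = 1 := by rw [S_sq, mul_one, hRinv₂]
  have BX : B * (Rinv * S * Rinv) = 1 := by
    calc B * (Rinv * S * Rinv) = R * S * (R * Rinv) * S * Rinv := by rw [hB]; simp only [mul_assoc]
      _ = R * (S * S) * Rinv := by rw [hRinv₁]; simp only [mul_assoc, mul_one, one_mul]
      _ = 1 := by rw [S_sq, mul_one, hRinv₁]
  have B_unit : IsUnit B := ⟨⟨B, _, BX, XB⟩, rfl⟩
  refine ⟨⟨B_sa, B_unit, fun x => ?_⟩, ?_⟩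
  · rw [B_J, J_neg, J_invol]
  intro 𝒰 ξ absB P hU1 hU2 hUJ hξ hM habs habs2 hP hP2
  rw [← ContinuousLinearMap.star_eq_adjoint] at hU1 hU2 hM
  intro 𝒱
  rw [← ContinuousLinearMap.star_eq_adjoint]
  have P_sa : star P = P := hP.isSelfAdjoint
  have absB_J : ∀ x, Jmap C (absB (Jmap C x)) = absB x :=
    pos_sqrt_comm (Jmap C) J_add J_smul J_inner J_invol absB habs (by
      rw [habs2]; intro x; simp [B_J, J_neg, J_invol])
  have P_J : ∀ x, P (Jmap C x) = Jmap C (P x) :=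
    comm P (pos_sqrt_comm (Jmap C) J_add J_smul J_inner J_invol P hP (by rw [hP2]; exact absB_J))
  have U_J := comm 𝒰 hUJ
  have units : ∀ T : DirectSum2 H →L[ℂ] DirectSum2 H, IsUnit (T * T) → IsUnit T := by
    intro T h
    exact ((Commute.refl T).isUnit_mul_iff.1 h).1
  have absB_unit : IsUnit absB := units _ (by rw [habs2]; exact B_unit.mul B_unit)
  have P_unit : IsUnit P := units _ (by rw [hP2]; exact absB_unit)
  have U_unit : IsUnit 𝒰 := ⟨⟨𝒰, star 𝒰, hU2, hU1⟩, rfl⟩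
  have Rinv_unit : IsUnit Rinv := ⟨⟨Rinv, R, hRinv₂, hRinv₁⟩, rfl⟩
  have V_unit : IsUnit 𝒱 := (U_unit.mul P_unit).mul Rinv_unit
  -- the block diagonal operator D = S M
  set M := 𝒰 * B * star 𝒰 with hMdef
  have MS : M * S = S * M := by
    ext1 x
    change M (S x) = S (M x)
    rw [← pairK_eta x]
    simp only [hS, hM, C_neg, map_neg]
  have D_apply : ∀ f g, (S * M) (pairK f g) = pairK (ξ f) (C (ξ (C g))) := by
    intro f g
    change S (M _) = _
    rw [hM, hS, neg_neg]
  have D_pos : (S * M).IsPositive := by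
    rw [ContinuousLinearMap.isPositive_iff_complex] at hξ ⊢
    intro x
    rw [← pairK_eta x, D_apply, inner_pairK]
    have e : ⟪C (ξ (C (sndK x))), sndK x⟫_ℂ = ⟪ξ (C (sndK x)), C (sndK x)⟫_ℂ := by
      conv_lhs => rw [← hC_invol (sndK x), hC_inner, hC_invol]
      obtain ⟨h1, h2⟩ := hξ (C (sndK x))
      rw [← inner_conj_symm, ← h1]
      simp
    rw [e]
    obtain ⟨h1, h2⟩ := hξ (C (sndK x))
    obtain ⟨h3, h4⟩ := hξ (fstK x)
    constructor
    · rw [← h1, ← h3]; simp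
    · simpa using add_nonneg h4 h2
  have absB_eq : 𝒰 * absB * star 𝒰 = S * M := by
    refine pos_sq_unique (habs.conj_adjoint 𝒰) D_pos ?_
    calc 𝒰 * absB * star 𝒰 * (𝒰 * absB * star 𝒰)
        = 𝒰 * absB * (star 𝒰 * 𝒰) * absB * star 𝒰 := by simp only [mul_assoc]
      _ = 𝒰 * (absB * absB) * star 𝒰 := by rw [hU1]; simp only [mul_assoc, mul_one, one_mul]
      _ = 𝒰 * B * (star 𝒰 * 𝒰) * B * star 𝒰 := by
          rw [hU1, habs2]; simp only [mul_assoc, mul_one, one_mul]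
      _ = M * M := by rw [hMdef]; simp only [mul_assoc]
      _ = (S * S) * M * M := by rw [S_sq, one_mul]
      _ = S * (S * M) * M := by simp only [mul_assoc]
      _ = S * (M * S) * M := by rw [MS]
      _ = S * M * (S * M) := by simp only [mul_assoc]
  -- W = U* S U
  obtain ⟨W, hW⟩ : ∃ W, W = star 𝒰 * S * 𝒰 := ⟨_, rfl⟩
  have W_sa : star W = W := by rw [hW]; simp [S_sa', mul_assoc]
  have W_sq : W * W = 1 := by
    calc W * W = star 𝒰 * S * (𝒰 * star 𝒰) * S * 𝒰 := by rw [hW]; simp only [mul_assoc]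
      _ = star 𝒰 * (S * S) * 𝒰 := by rw [hU2]; simp only [mul_assoc, mul_one]
      _ = 1 := by rw [S_sq, mul_one, hU1]
  have UWU : 𝒰 * W * star 𝒰 = S := by
    calc 𝒰 * W * star 𝒰 = (𝒰 * star 𝒰) * S * (𝒰 * star 𝒰) := by rw [hW]; simp only [mul_assoc]
      _ = S := by rw [hU2, mul_one, one_mul]
  have absB1 : absB = W * B := by
    calc absB = (star 𝒰 * 𝒰) * absB * (star 𝒰 * 𝒰) := by rw [hU1, mul_one, one_mul]
      _ = star 𝒰 * (𝒰 * absB * star 𝒰) * 𝒰 := by simp only [mul_assoc]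
      _ = star 𝒰 * S * 𝒰 * B * (star 𝒰 * 𝒰) := by rw [absB_eq, hMdef]; simp only [mul_assoc]
      _ = W * B := by rw [hU1, mul_one, hW]
  have absB2 : absB = B * W := by
    have h := congrArg star absB1
    have h' : star absB = absB := habs.isSelfAdjoint
    rwa [h', star_mul, B_sa, W_sa] at h
  have WB : B = W * absB := by rw [absB1, ← mul_assoc, W_sq, one_mul]
  have PW : W * P * W = P := by
    have hpos : (W * P * star W).IsPositive := hP.conj_adjoint W
    rw [W_sa] at hpos
    refine pos_sq_unique hpos hP ?_
    calc W * P * W * (W * P * W) = W * P * (W * W) * P * W := by simp only [mul_assoc]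
      _ = W * (P * P) * W := by rw [W_sq]; simp only [mul_assoc, one_mul]
      _ = W * (B * W) * W := by rw [hP2, ← absB2]
      _ = W * B * (W * W) := by simp only [mul_assoc]
      _ = P * P := by rw [W_sq, mul_one, hP2, absB1]
  have PW' : P * W = W * P := by
    calc P * W = W * P * W * W := by rw [PW]
      _ = W * P * (W * W) := by simp only [mul_assoc]
      _ = W * P := by rw [W_sq, mul_one]
  obtain ⟨X, hX⟩ : ∃ X, X = Rinv * S * Rinv := ⟨_, rfl⟩
  have PXP : P * X * P = W := by
    apply P_unit.mul_right_cancel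
    rw [← PW']
    calc P * X * P * P = P * (X * (P * P)) := by simp only [mul_assoc]
      _ = P * (X * B * W) := by rw [hP2, absB2]; simp only [mul_assoc]
      _ = P * W := by rw [hX, XB, one_mul]
  have V_star : star 𝒱 = Rinv * P * star 𝒰 := by
    simp only [𝒱, star_mul, Rinv_sa, P_sa, mul_assoc]
  have VSV : 𝒱 * S * star 𝒱 = S := by
    calc 𝒱 * S * star 𝒱 = 𝒰 * (P * X * P) * star 𝒰 := by
          rw [V_star, hX]; simp only [𝒱, mul_assoc]
      _ = S := by rw [PXP, UWU]
  refine ⟨V_unit, fun x => ?_, ?_, VSV, ?_⟩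
  · simp [𝒱, Rinv_J, P_J, U_J, J_invol]
  · have h1 : 𝒱 * (S * star 𝒱 * S) = 1 := by
      calc 𝒱 * (S * star 𝒱 * S) = 𝒱 * S * star 𝒱 * S := by simp only [mul_assoc]
        _ = 1 := by rw [VSV, S_sq]
    have h2 : (S * star 𝒱 * S) * 𝒱 = 1 := by
      apply V_unit.mul_left_cancel
      rw [← mul_assoc, h1, one_mul, mul_one]
    calc star 𝒱 * S * 𝒱 = (S * S) * star 𝒱 * S * 𝒱 := by rw [S_sq, one_mul]
      _ = S * ((S * star 𝒱 * S) * 𝒱) := by simp only [mul_assoc]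
      _ = S := by rw [h2, mul_one]
  · intro f g
    have : 𝒱 * 𝒜 * star 𝒱 = S * M := by
      calc 𝒱 * 𝒜 * star 𝒱 = 𝒰 * P * (Rinv * R) * (R * Rinv) * P * star 𝒰 := by
            rw [V_star, ← hR_sq]; simp only [𝒱, mul_assoc]
        _ = 𝒰 * (P * P) * star 𝒰 := by rw [hRinv₁, hRinv₂]; simp only [mul_assoc, one_mul]
        _ = S * M := by rw [hP2, absB_eq]
    rw [this, D_apply]

end
end

section
/- There exist constants C₁, C₂ > 0 such that for every g ∈ [0, 1), the real 2×2 matrix V(g) := c(g)·[[1, −a(g)], [−a(g), 1]], where s(g) := √(1 − g²), a(g) := g/(1 + s(g)) and c(g) := √(1/2 + 1/(2 s(g))), satisfies C₁ (1 − g)^{−1/4} ≤ ‖V(g)‖ ≤ C₂ (1 − g)^{−1/4}, where ‖·‖ denotes the ℓ²-operator norm on ℝ². -/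
open Matrix

lemma le_of_sq_le_sq_aux {x y : ℝ} (h : x ^ 2 ≤ y ^ 2) (hy : 0 ≤ y) : x ≤ y :=
  (le_abs_self x).trans (abs_le_of_sq_le_sq h hy)

lemma norm_V_aux (a c : ℝ) (ha : 0 ≤ a) (hc : 0 ≤ c) :
    ‖Matrix.toEuclideanCLM (𝕜 := ℝ) (c • !![1, -a; -a, 1] : Matrix (Fin 2) (Fin 2) ℝ)‖
      = c * (1 + a) := by
  have hn : 0 ≤ c * (1 + a) := by positivity
  have key : ∀ x : EuclideanSpace ℝ (Fin 2),
      ‖Matrix.toEuclideanCLM (𝕜 := ℝ) (c • !![1, -a; -a, 1] : Matrix (Fin 2) (Fin 2) ℝ) x‖ ^ 2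
        = c ^ 2 * ((x 0 - a * x 1) ^ 2 + (x 1 - a * x 0) ^ 2) := by
    intro x
    rw [EuclideanSpace.norm_sq_eq]
    simp [Fin.sum_univ_two, Matrix.ofLp_toEuclideanCLM, Matrix.mulVec, dotProduct]
    ring
  apply le_antisymm
  · refine ContinuousLinearMap.opNorm_le_bound _ hn fun x => ?_
    refine le_of_sq_le_sq_aux ?_ (by positivity)
    rw [key, mul_pow, EuclideanSpace.norm_sq_eq]
    simp only [Fin.sum_univ_two, Real.norm_eq_abs, sq_abs]
    have h : 0 ≤ c ^ 2 * (2 * a * (x 0 + x 1) ^ 2) := by positivity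
    nlinarith [h]
  · have hx : ‖(!₂[1, -1] : EuclideanSpace ℝ (Fin 2))‖ ^ 2 = 2 := by
      rw [EuclideanSpace.norm_sq_eq]
      simp [Fin.sum_univ_two]
      norm_num
    have hN0 := norm_nonneg (Matrix.toEuclideanCLM (𝕜 := ℝ)
      (c • !![1, -a; -a, 1] : Matrix (Fin 2) (Fin 2) ℝ))
    have h := ContinuousLinearMap.le_opNorm (Matrix.toEuclideanCLM (𝕜 := ℝ)
      (c • !![1, -a; -a, 1] : Matrix (Fin 2) (Fin 2) ℝ)) !₂[1, -1]
    have h2 := pow_le_pow_left₀ (norm_nonneg _) h 2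
    rw [key, mul_pow, hx] at h2
    generalize ‖Matrix.toEuclideanCLM (𝕜 := ℝ) (c • !![1, -a; -a, 1] : Matrix (Fin 2) (Fin 2) ℝ)‖ = N at *
    simp at h2
    refine le_of_sq_le_sq_aux ?_ hN0
    nlinarith [h2]

/-- optimality of the norm bound in the commutative example.
There are constants `C₁, C₂ > 0` such that for all `g ∈ [0,1)` the ℓ²-operator
norm of the Bogoliubov matrix `V(g) = c(g)·[[1,−a(g)],[−a(g),1]]`, where
`s(g)=√(1−g²)`, `a(g)=g/(1+s(g))`, `c(g)=√(1/2+1/(2s(g)))`, is comparable to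
`(1−g)^{−1/4}`. -/
theorem norm_V_comparable_optimal :
    ∃ C₁ C₂ : ℝ, 0 < C₁ ∧ 0 < C₂ ∧
      ∀ g : ℝ, g ∈ Set.Ico (0 : ℝ) 1 →
        (let s : ℝ := Real.sqrt (1 - g ^ 2)
         let a : ℝ := g / (1 + s)
         let c : ℝ := Real.sqrt (1 / 2 + 1 / (2 * s))
         let V : Matrix (Fin 2) (Fin 2) ℝ := c • !![1, -a; -a, 1]
         C₁ * (1 - g) ^ (-(1 / 4 : ℝ)) ≤ ‖Matrix.toEuclideanCLM (𝕜 := ℝ) V‖ ∧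
           ‖Matrix.toEuclideanCLM (𝕜 := ℝ) V‖ ≤ C₂ * (1 - g) ^ (-(1 / 4 : ℝ))) := by
  refine ⟨1, 2, one_pos, two_pos, ?_⟩
  rintro g ⟨hg0, hg1⟩
  intro s a c V
  have h1 : 0 < 1 - g := by linarith
  have hq : 0 < 1 - g ^ 2 := by nlinarith
  have hs : 0 < s := Real.sqrt_pos.2 hq
  have hs2 : s ^ 2 = 1 - g ^ 2 := Real.sq_sqrt hq.le
  have ha : 0 ≤ a := by positivity
  have hc : 0 ≤ c := Real.sqrt_nonneg _
  have hc2 : c ^ 2 = 1 / 2 + 1 / (2 * s) := Real.sq_sqrt (by positivity)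
  have hN : ‖Matrix.toEuclideanCLM (𝕜 := ℝ) V‖ = c * (1 + a) := norm_V_aux a c ha hc
  rw [hN]
  have hN0 : 0 ≤ c * (1 + a) := by positivity
  have hN2 : (c * (1 + a)) ^ 2 = (1 + g) / s := by
    have ha' : a = g / (1 + s) := rfl
    rw [mul_pow, hc2, ha']
    clear_value s
    field_simp
    linear_combination (1 + s) * hs2
  have hN4 : (c * (1 + a)) ^ 4 * (1 - g) = 1 + g := by
    have : (c * (1 + a)) ^ 4 = ((c * (1 + a)) ^ 2) ^ 2 := by ring
    rw [this, hN2, div_pow, hs2]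
    field_simp
    ring
  have ht0 : 0 < (1 - g) ^ (-(1 / 4 : ℝ)) := Real.rpow_pos_of_pos h1 _
  have ht4 : ((1 - g) ^ (-(1 / 4 : ℝ))) ^ 4 * (1 - g) = 1 := by
    rw [← Real.rpow_natCast, ← Real.rpow_mul h1.le]
    norm_num
    rw [Real.rpow_neg_one]
    field_simp
  generalize (1 - g) ^ (-(1 / 4 : ℝ)) = t at *
  constructor
  · refine (pow_le_pow_iff_left₀ (by positivity) hN0 (n := 4) (by norm_num)).1 ?_
    refine le_of_mul_le_mul_right ?_ h1
    rw [hN4, one_mul, ht4]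
    linarith
  · refine (pow_le_pow_iff_left₀ hN0 (by positivity) (n := 4) (by norm_num)).1 ?_
    refine le_of_mul_le_mul_right ?_ h1
    rw [hN4, mul_pow, mul_assoc, ht4]
    linarith
end

section
/- Let H be a complex Hilbert space with a conjugation C; for a bounded operator X on H write Xᵀ := C X* C and X̄ := C X C. Let h, K : [0, ∞) → B(H) be norm-continuous maps of bounded operators with h(t) self-adjoint and K(t)ᵀ = K(t) for all t. Let γ, α : [0, ∞) → B(H) be continuously differentiable in operator norm, with γ(t) self-adjoint and α(t)ᵀ = α(t) for all t, satisfying the system i γ′(t) = h(t) γ(t) − γ(t) h(t) + K(t) α(t)* − α(t) K(t)* and i α′(t) = h(t) α(t) + α(t) h(t)ᵀ + K(t) + K(t) γ(t)ᵀ + γ(t) K(t). If γ(0) + γ(0)² − α(0) α(0)* = 0 and γ(0) α(0) − α(0) γ(0)ᵀ = 0, then for every t ≥ 0 one has γ(t) + γ(t)² − α(t) α(t)* = 0 and γ(t) α(t) − α(t) γ(t)ᵀ = 0. -/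
open scoped InnerProductSpace
open ContinuousLinearMap Set

theorem qf_abstract {A : Type*} [CStarAlgebra A] (T : A →L[ℂ] A)
    (hTm : ∀ x y, T (x * y) = T y * T x) (hTs : ∀ x, T (star x) = star (T x))
    (hTn : ∀ x, ‖T x‖ ≤ ‖x‖)
    (h K γ α γ' α' : ℝ → A)
    (hh_cont : ContinuousOn h (Ici 0)) (hK_cont : ContinuousOn K (Ici 0))
    (hh_sa : ∀ t ∈ Ici (0:ℝ), star (h t) = h t)
    (hK_symm : ∀ t ∈ Ici (0:ℝ), T (K t) = K t)
    (hγ_deriv : ∀ t ∈ Ici (0:ℝ), HasDerivWithinAt γ (γ' t) (Ici 0) t)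
    (hα_deriv : ∀ t ∈ Ici (0:ℝ), HasDerivWithinAt α (α' t) (Ici 0) t)
    (hγ_sa : ∀ t ∈ Ici (0:ℝ), star (γ t) = γ t)
    (hα_symm : ∀ t ∈ Ici (0:ℝ), T (α t) = α t)
    (heq_γ : ∀ t ∈ Ici (0:ℝ), (Complex.I : ℂ) • γ' t =
      h t * γ t - γ t * h t + K t * star (α t) - α t * star (K t))
    (heq_α : ∀ t ∈ Ici (0:ℝ), (Complex.I : ℂ) • α' t =
      h t * α t + α t * T (h t) + K t + K t * T (γ t) + γ t * K t)
    (hX0 : γ 0 + γ 0 * γ 0 - α 0 * star (α 0) = 0)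
    (hY0 : γ 0 * α 0 - α 0 * T (γ 0) = 0) :
    ∀ t ∈ Ici (0:ℝ),
      γ t + γ t * γ t - α t * star (α t) = 0 ∧ γ t * α t - α t * T (γ t) = 0 := by
  set X : ℝ → A := fun t => γ t + γ t * γ t - α t * star (α t) with hX
  set Y : ℝ → A := fun t => γ t * α t - α t * T (γ t) with hY
  set X' : ℝ → A := fun t => γ' t + (γ' t * γ t + γ t * γ' t)
    - (α' t * star (α t) + α t * star (α' t)) with hX'
  set Y' : ℝ → A := fun t => (γ' t * α t + γ t * α' t)
    - (α' t * T (γ t) + α t * T (γ' t)) with hY'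
  have hneg : ∀ {x y : A}, Complex.I • x = y → x = (-Complex.I) • y := by
    intro x y hxy
    rw [← hxy, smul_smul]; simp
  have hXd : ∀ t ∈ Ici (0:ℝ), HasDerivWithinAt X (X' t) (Ici 0) t := fun t ht =>
    ((hγ_deriv t ht).add ((hγ_deriv t ht).mul (hγ_deriv t ht))).sub
      ((hα_deriv t ht).mul (hα_deriv t ht).star)
  have hTd : ∀ t ∈ Ici (0:ℝ), HasDerivWithinAt (fun s => T (γ s)) (T (γ' t)) (Ici 0) t :=
    fun t ht => (T.restrictScalars ℝ).hasFDerivAt.comp_hasDerivWithinAt t (hγ_deriv t ht)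
  have hYd : ∀ t ∈ Ici (0:ℝ), HasDerivWithinAt Y (Y' t) (Ici 0) t := fun t ht =>
    ((hγ_deriv t ht).mul (hα_deriv t ht)).sub ((hα_deriv t ht).mul (hTd t ht))
  have eX : ∀ t ∈ Ici (0:ℝ), X' t = (-Complex.I) •
      (h t * X t - X t * h t + K t * star (Y t) - Y t * star (K t)) := by
    intro t ht
    have e1 := hneg (heq_γ t ht)
    have e2 := hneg (heq_α t ht)
    simp only [hX', hX, hY, e1, e2, star_smul, star_add, star_sub, star_mul, star_star,
      hγ_sa t ht, hh_sa t ht, ← hTs, smul_mul_assoc, mul_smul_comm, star_neg, neg_smul,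
      Complex.star_def, Complex.conj_I, neg_neg]
    simp only [neg_mul, mul_neg, smul_mul_assoc, mul_smul_comm, neg_neg]
    simp only [sub_eq_add_neg, ← smul_neg, ← smul_add]
    congr 1
    noncomm_ring
  have eY : ∀ t ∈ Ici (0:ℝ), Y' t = (-Complex.I) •
      (h t * Y t + Y t * T (h t) + X t * K t - K t * T (X t)) := by
    intro t ht
    have e1 := hneg (heq_γ t ht)
    have e2 := hneg (heq_α t ht)
    simp only [hY', hX, hY, e1, e2, map_smul, map_add, map_sub, hTm, hTs, hα_symm t ht,
      hK_symm t ht, smul_mul_assoc, mul_smul_comm, neg_smul]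
    simp only [map_neg, map_smul, map_add, map_sub, hTm, hTs, hα_symm t ht,
      hK_symm t ht, smul_mul_assoc, mul_smul_comm, neg_smul, neg_mul, mul_neg]
    simp only [sub_eq_add_neg, ← smul_neg, ← smul_add]
    congr 1
    noncomm_ring
  intro b hb
  have hsub : Icc 0 b ⊆ Ici (0:ℝ) := Icc_subset_Ici_self
  obtain ⟨M, hM⟩ := isCompact_Icc.exists_bound_of_continuousOn (hh_cont.mono hsub)
  obtain ⟨N, hN⟩ := isCompact_Icc.exists_bound_of_continuousOn (hK_cont.mono hsub)
  have key := norm_le_gronwallBound_of_norm_deriv_right_le (f := fun t => (X t, Y t))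
    (f' := fun t => (X' t, Y' t)) (δ := 0) (K := 2 * M + 2 * N) (ε := 0) (a := 0) (b := b)
    (fun t ht => (((hXd t (hsub ht)).prodMk (hYd t (hsub ht))).continuousWithinAt).mono hsub)
    (fun t ht => ((hXd t ht.1).prodMk (hYd t ht.1)).mono (Ici_subset_Ici.2 ht.1))
    (by simp [hX, hY, hX0, hY0])
    (by
      intro t ht
      have htI : t ∈ Icc 0 b := ⟨ht.1, ht.2.le⟩
      have hMt := hM t htI
      have hNt := hN t htI
      have hx : ‖X t‖ ≤ ‖(X t, Y t)‖ := norm_fst_le (X t, Y t)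
      have hy : ‖Y t‖ ≤ ‖(X t, Y t)‖ := norm_snd_le (X t, Y t)
      set n := ‖(X t, Y t)‖
      have hM0 : 0 ≤ M := (norm_nonneg _).trans hMt
      have hN0 : 0 ≤ N := (norm_nonneg _).trans hNt
      have mb : ∀ {x y : A} {c d : ℝ}, 0 ≤ c → ‖x‖ ≤ c → ‖y‖ ≤ d → ‖x * y‖ ≤ c * d :=
        fun hc h1 h2 => (norm_mul_le _ _).trans
          (mul_le_mul h1 h2 (norm_nonneg _) hc)
      have hn0 : 0 ≤ n := norm_nonneg _
      rw [add_zero]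
      refine max_le ?_ ?_
      · change ‖X' t‖ ≤ _
        rw [eX t ht.1, norm_smul, norm_neg, Complex.norm_I, one_mul]
        have a1 := mb hM0 hMt hx
        have a2 := mb hn0 hx hMt
        have a3 := mb hN0 hNt ((norm_star (Y t)).le.trans hy)
        have a4 := mb hn0 hy ((norm_star (K t)).le.trans hNt)
        have b1 := norm_sub_le (h t * X t - X t * h t + K t * star (Y t)) (Y t * star (K t))
        have b2 := norm_add_le (h t * X t - X t * h t) (K t * star (Y t))
        have b3 := norm_sub_le (h t * X t) (X t * h t)
        linarith
      · change ‖Y' t‖ ≤ _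
        rw [eY t ht.1, norm_smul, norm_neg, Complex.norm_I, one_mul]
        have a1 := mb hM0 hMt hy
        have a2 := mb hn0 hy ((hTn (h t)).trans hMt)
        have a3 := mb hn0 hx hNt
        have a4 := mb hN0 hNt ((hTn (X t)).trans hx)
        have b1 := norm_sub_le (h t * Y t + Y t * T (h t) + X t * K t) (K t * T (X t))
        have b2 := norm_add_le (h t * Y t + Y t * T (h t)) (X t * K t)
        have b3 := norm_add_le (h t * Y t) (Y t * T (h t))
        linarith) b ⟨hb, le_rfl⟩
  rw [gronwallBound_ε0_δ0] at key
  have := norm_le_zero_iff.1 key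
  exact Prod.mk_eq_zero.1 this

/-- preservation of the quasi-free property under the Bogoliubov
evolution.  Let `H` be a complex Hilbert space with a conjugation `C` and write
`Xᵀ = C X* C` for bounded `X`.  Let `h(t)` (self-adjoint) and `K(t)` (with
`K(t)ᵀ = K(t)`) be norm-continuous families of bounded operators, and let
`(γ, α)` be continuously differentiable (in operator norm) with `γ(t)`
self-adjoint and `α(t)ᵀ = α(t)`, solving
`iγ′ = hγ − γh + Kα* − αK*` and `iα′ = hα + αhᵀ + K + Kγᵀ + γK` on `[0, ∞)`.
If `γ + γ² − αα* = 0` and `γα − αγᵀ = 0` at `t = 0`, then these hold for all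
`t ≥ 0`. -/
theorem quasi_free_preserved
    {H : Type*} [NormedAddCommGroup H] [InnerProductSpace ℂ H] [CompleteSpace H]
    -- the conjugation C
    (C : H → H)
    (hC_add : ∀ f g, C (f + g) = C f + C g)
    (hC_smul : ∀ (a : ℂ) (f : H), C (a • f) = (starRingEnd ℂ a) • C f)
    (hC_inner : ∀ f g : H, ⟪C f, C g⟫_ℂ = ⟪g, f⟫_ℂ)
    (hC_invol : ∀ f, C (C f) = f)
    -- the transpose map X ↦ Xᵀ = C X* C
    (T : (H →L[ℂ] H) → (H →L[ℂ] H))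
    (hT : ∀ (X : H →L[ℂ] H) (f : H), T X f = C (ContinuousLinearMap.adjoint X (C f)))
    -- the coefficients h(t), K(t)
    (h K : ℝ → (H →L[ℂ] H))
    (hh_cont : ContinuousOn h (Ici 0)) (hK_cont : ContinuousOn K (Ici 0))
    (hh_sa : ∀ t ∈ Ici (0:ℝ), IsSelfAdjoint (h t))
    (hK_symm : ∀ t ∈ Ici (0:ℝ), T (K t) = K t)
    -- the solution (γ(t), α(t)) and its derivative
    (γ α γ' α' : ℝ → (H →L[ℂ] H))
    (hγ_deriv : ∀ t ∈ Ici (0:ℝ), HasDerivWithinAt γ (γ' t) (Ici 0) t)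
    (hα_deriv : ∀ t ∈ Ici (0:ℝ), HasDerivWithinAt α (α' t) (Ici 0) t)
    (hγ'_cont : ContinuousOn γ' (Ici 0)) (hα'_cont : ContinuousOn α' (Ici 0))
    (hγ_sa : ∀ t ∈ Ici (0:ℝ), IsSelfAdjoint (γ t))
    (hα_symm : ∀ t ∈ Ici (0:ℝ), T (α t) = α t)
    -- the evolution equations
    (heq_γ : ∀ t ∈ Ici (0:ℝ), (Complex.I : ℂ) • γ' t =
      h t * γ t - γ t * h t + K t * ContinuousLinearMap.adjoint (α t)
        - α t * ContinuousLinearMap.adjoint (K t))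
    (heq_α : ∀ t ∈ Ici (0:ℝ), (Complex.I : ℂ) • α' t =
      h t * α t + α t * T (h t) + K t + K t * T (γ t) + γ t * K t)
    -- quasi-free initial data
    (hX0 : γ 0 + γ 0 * γ 0 - α 0 * ContinuousLinearMap.adjoint (α 0) = 0)
    (hY0 : γ 0 * α 0 - α 0 * T (γ 0) = 0) :
    ∀ t ∈ Ici (0:ℝ),
      γ t + γ t * γ t - α t * ContinuousLinearMap.adjoint (α t) = 0 ∧
      γ t * α t - α t * T (γ t) = 0 := by
  have hCn : ∀ f, ‖C f‖ = ‖f‖ := by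
    intro f
    have := hC_inner f f
    rw [inner_self_eq_norm_sq_to_K, inner_self_eq_norm_sq_to_K] at this
    have h2 : ‖C f‖ ^ 2 = ‖f‖ ^ 2 := by exact_mod_cast this
    exact (sq_eq_sq₀ (norm_nonneg _) (norm_nonneg _)).1 h2
  have hTn : ∀ X, ‖T X‖ ≤ ‖X‖ := by
    intro X
    refine ContinuousLinearMap.opNorm_le_bound _ (norm_nonneg _) fun f => ?_
    rw [hT, hCn]
    refine (ContinuousLinearMap.le_opNorm _ _).trans ?_
    rw [hCn, LinearIsometryEquiv.norm_map]
  let T₀ : (H →L[ℂ] H) →ₗ[ℂ] (H →L[ℂ] H) :=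
    { toFun := T
      map_add' := by
        intro X Y; ext f
        simp [hT, hC_add]
      map_smul' := by
        intro a X; ext f
        have e : ContinuousLinearMap.adjoint (a • X)
            = (starRingEnd ℂ a) • ContinuousLinearMap.adjoint X := map_smulₛₗ _ _ _
        simp [hT, hC_smul, e] }
  let T₁ : (H →L[ℂ] H) →L[ℂ] (H →L[ℂ] H) := T₀.mkContinuous 1 (fun X => by
    rw [one_mul]; exact hTn X)
  have hCs : ∀ f g, ⟪C f, g⟫_ℂ = ⟪C g, f⟫_ℂ := by
    intro f g
    rw [← hC_inner, hC_invol]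
  have hTm : ∀ X Y, T₁ (X * Y) = T₁ Y * T₁ X := by
    intro X Y
    change T (X * Y) = T Y * T X
    ext f
    simp only [hT, ContinuousLinearMap.mul_apply, hC_invol]
    rw [← ContinuousLinearMap.star_eq_adjoint, star_mul]
    rfl
  have hTs : ∀ X, T₁ (star X) = star (T₁ X) := by
    intro X
    change T (star X) = star (T X)
    rw [ContinuousLinearMap.star_eq_adjoint, ContinuousLinearMap.star_eq_adjoint,
      ContinuousLinearMap.eq_adjoint_iff]
    intro f g
    rw [hT, hT, ContinuousLinearMap.adjoint_adjoint, hCs, ← ContinuousLinearMap.adjoint_inner_left,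
      ← hC_inner, hC_invol]
  exact qf_abstract T₁ hTm hTs hTn h K γ α γ' α' hh_cont hK_cont hh_sa hK_symm hγ_deriv
    hα_deriv hγ_sa hα_symm heq_γ heq_α hX0 hY0
end

section
/- Let P, Q ∈ Mₙ(ℂ) with P* = P and Qᵀ = −Q, and let B := [[P, Q], [−Q̄, −P̄]] ∈ M₂ₙ(ℂ) (which is Hermitian). Assume that dim Ker(B) is even (possibly 0). Then there exist A₀, B₀ ∈ Mₙ(ℂ) such that 𝒰 := [[A₀, B₀], [B̄₀, Ā₀]] is unitary and 𝒰 B 𝒰* = [[ξ, 0], [0, −ξ̄]] for some Hermitian positive semidefinite ξ ∈ Mₙ(ℂ). Moreover, if B is invertible, then ξ can be chosen positive definite. -/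
open Matrix
open scoped ComplexOrder

/-- Entrywise complex conjugate of a matrix. -/
def Mconj {n : ℕ} (M : Matrix (Fin n) (Fin n) ℂ) : Matrix (Fin n) (Fin n) ℂ :=
  M.map (starRingEnd ℂ)

section abstractLemmas
variable {V : Type*} [NormedAddCommGroup V] [InnerProductSpace ℂ V] [FiniteDimensional ℂ V]

/-- One step: find a unit eigenvector orthogonal to its conjugate. -/
theorem fbd_step (T : V →ₗ[ℂ] V) (hT : T.IsSymmetric) (J : V →ₛₗ[starRingEnd ℂ] V)
    (hJJ : ∀ x, J (J x) = x) (hJ : ∀ x y, inner ℂ (J x) (J y) = inner ℂ y x)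
    (hTJ : ∀ x, T (J x) = - J (T x)) (S : Submodule ℂ V)
    (hST : ∀ x ∈ S, T x ∈ S) (hSJ : ∀ x ∈ S, J x ∈ S) (hS : 2 ≤ Module.finrank ℂ S) :
    ∃ x ∈ S, inner ℂ x x = (1 : ℂ) ∧ inner ℂ x (J x) = (0 : ℂ) ∧
      ∃ l : ℝ, 0 ≤ l ∧ T x = (l : ℂ) • x := by
  -- it suffices to find a nonzero vector
  suffices h : ∃ x ∈ S, x ≠ 0 ∧ inner ℂ x (J x) = (0 : ℂ) ∧
      ∃ l : ℝ, 0 ≤ l ∧ T x = (l : ℂ) • x by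
    obtain ⟨x, hx, hx0, hxJ, l, hl, hTx⟩ := h
    refine ⟨((‖x‖⁻¹ : ℝ) : ℂ) • x, S.smul_mem _ hx, ?_, ?_, l, hl, ?_⟩
    · have : ‖x‖ ≠ 0 := norm_ne_zero_iff.2 hx0
      rw [inner_smul_left, inner_smul_right, inner_self_eq_norm_sq_to_K]
      have h2 : (‖x‖ : ℂ) ≠ 0 := by exact_mod_cast this
      rw [Complex.conj_ofReal, Complex.ofReal_inv]
      have h3 : ∀ a : ℂ, a ≠ 0 → a⁻¹ * (a⁻¹ * a ^ 2) = 1 := fun a ha => by field_simp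
      exact h3 _ h2
    · simp [map_smulₛₗ, inner_smul_left, inner_smul_right, hxJ]
    · rw [map_smul, hTx, smul_comm]
  by_cases h0 : ∀ x ∈ S, T x = 0
  · -- isotropic vector
    obtain ⟨v, hv⟩ := exists_linearIndependent_of_le_finrank hS
    have hx := (v 0).2
    have hy := (v 1).2
    have hli := LinearIndependent.pair_iff.1 (show LinearIndependent ℂ ![v 0, v 1] by
      convert hv using 1
      ext i; fin_cases i <;> rfl)
    set x : V := (v 0 : V) with hxdef
    set y : V := (v 1 : V) with hydef
    have hli' : ∀ s t : ℂ, s • x + t • y = 0 → s = 0 ∧ t = 0 := by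
      intro s t h
      apply hli s t
      apply Subtype.ext
      simpa [hxdef, hydef] using h
    have hsymm : inner ℂ (J x) y = inner ℂ (J y) x := by
      have := hJ x (J y)
      rw [hJJ] at this
      exact this
    by_cases hb : inner ℂ (J y) y = (0 : ℂ)
    · refine ⟨y, hy, ?_, ?_, 0, le_rfl, by simp [h0 y hy]⟩
      · intro h
        have := hli' 0 1 (by simp [h])
        simp at this
      · rw [← inner_conj_symm, hb, map_zero]
    · obtain ⟨s, hs⟩ := IsAlgClosed.exists_pow_nat_eq
        (discrim (inner ℂ (J y) y) (2 * inner ℂ (J x) y) (inner ℂ (J x) x)) (n := 2) (by norm_num)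
      obtain ⟨t, ht⟩ := exists_quadratic_eq_zero hb ⟨s, by rw [← hs]; ring⟩
      refine ⟨x + t • y, S.add_mem hx (S.smul_mem _ hy), ?_, ?_, 0, le_rfl, ?_⟩
      · intro h
        have := hli' 1 t (by simpa using h)
        simp at this
      · rw [← inner_conj_symm]
        have : inner ℂ (J (x + t • y)) (x + t • y) = (0 : ℂ) := by
          simp only [map_add, map_smulₛₗ, inner_add_left, inner_add_right, inner_smul_left,
            inner_smul_right, ← hsymm, Complex.conj_conj]
          linear_combination ht
        rw [this, map_zero]
      · rw [h0 _ (S.add_mem hx (S.smul_mem _ hy))]; simp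
  · -- nonzero eigenvalue
    have hR := hT.restrict_invariant hST
    obtain ⟨x, l, hx, hx0, hl, hTx⟩ : ∃ x : V, ∃ l : ℝ, x ∈ S ∧ x ≠ 0 ∧ l ≠ 0 ∧
        T x = (l : ℂ) • x := by
      by_contra hcon
      push Not at hcon
      apply h0
      have hz : T.restrict hST = 0 := by
        apply (hR.eigenvectorBasis rfl).toBasis.ext
        intro i
        simp only [OrthonormalBasis.coe_toBasis, LinearMap.zero_apply]
        have h1 := hR.apply_eigenvectorBasis rfl i
        have h2 := congrArg Subtype.val h1
        by_cases hl : hR.eigenvalues rfl i = 0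
        · rw [h1, hl]; simp
        · exfalso
          refine hcon (hR.eigenvectorBasis rfl i : S) (hR.eigenvalues rfl i) (Subtype.property _)
            ?_ hl ?_
          · intro h
            have := (hR.eigenvectorBasis rfl).orthonormal.ne_zero i
            exact this (Subtype.ext h)
          · exact h2
      intro x hx
      have := congrArg Subtype.val (LinearMap.congr_fun hz ⟨x, hx⟩)
      simpa using this
    have hTJx : T (J x) = -((l : ℂ) • J x) := by
      rw [hTJ, hTx, map_smulₛₗ, Complex.conj_ofReal]
    have horth : inner ℂ x (J x) = (0 : ℂ) := by
      have h := hT x (J x)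
      rw [hTx, hTJx, inner_smul_left, inner_neg_right, inner_smul_right,
        Complex.conj_ofReal] at h
      have h2 : (l : ℂ) ≠ 0 := by exact_mod_cast hl
      have h3 : (l : ℂ) * inner ℂ x (J x) = 0 := by linear_combination h / 2
      exact (mul_eq_zero.1 h3).resolve_left h2
    rcases le_total 0 l with hl0 | hl0
    · exact ⟨x, hx, hx0, horth, l, hl0, hTx⟩
    · refine ⟨J x, hSJ x hx, ?_, ?_, -l, by linarith, ?_⟩
      · intro h; apply hx0; rw [← hJJ x, h, map_zero]
      · rw [hJJ, ← inner_conj_symm, horth, map_zero]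
      · rw [hTJx]; simp

theorem fbd_family (T : V →ₗ[ℂ] V) (hT : T.IsSymmetric) (J : V →ₛₗ[starRingEnd ℂ] V)
    (hJJ : ∀ x, J (J x) = x) (hJ : ∀ x y, inner ℂ (J x) (J y) = inner ℂ y x)
    (hTJ : ∀ x, T (J x) = - J (T x)) (k : ℕ) (hk : 2 * k ≤ Module.finrank ℂ V) :
    ∃ (u : Fin k → V) (l : Fin k → ℝ), (∀ i j, inner ℂ (u i) (u j) = if i = j then (1 : ℂ) else 0) ∧
      (∀ i j, inner ℂ (u i) (J (u j)) = (0 : ℂ)) ∧ (∀ i, 0 ≤ l i) ∧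
      ∀ i, T (u i) = (l i : ℂ) • u i := by
  induction k with
  | zero => exact ⟨fun i => i.elim0, fun i => i.elim0, fun i => i.elim0, fun i => i.elim0,
      fun i => i.elim0, fun i => i.elim0⟩
  | succ k ih =>
    obtain ⟨u, l, h1, h2, h3, h4⟩ := ih (by omega)
    set w : Fin k ⊕ Fin k → V := Sum.elim u (fun i => J (u i)) with hw
    set S := (Submodule.span ℂ (Set.range w))ᗮ with hSdef
    have hmem : ∀ x, x ∈ S ↔ ∀ i, inner ℂ (u i) x = (0 : ℂ) ∧ inner ℂ (J (u i)) x = (0 : ℂ) := by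
      intro x
      constructor
      · intro hx i
        rw [hSdef, Submodule.mem_orthogonal] at hx
        exact ⟨hx _ (Submodule.subset_span ⟨Sum.inl i, rfl⟩),
          hx _ (Submodule.subset_span ⟨Sum.inr i, rfl⟩)⟩
      · intro hx
        rw [hSdef, Submodule.mem_orthogonal]
        intro z hz
        induction hz using Submodule.span_induction with
        | mem z hz =>
          obtain ⟨i | i, rfl⟩ := hz
          · exact (hx i).1
          · exact (hx i).2
        | zero => simp
        | add a b _ _ ha hb => rw [inner_add_left, ha, hb, add_zero]
        | smul c a _ ha => rw [inner_smul_left, ha, mul_zero]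
    have hdim : 2 ≤ Module.finrank ℂ S := by
      have e := Submodule.finrank_add_finrank_orthogonal (Submodule.span ℂ (Set.range w))
      have f : Module.finrank ℂ (Submodule.span ℂ (Set.range w)) ≤ _ := finrank_range_le_card w
      simp only [Fintype.card_sum, Fintype.card_fin] at f
      rw [← hSdef] at e
      omega
    obtain ⟨x, hx, hxx, hxJ, m, hm, hTx⟩ := fbd_step T hT J hJJ hJ hTJ S
      (by
        intro x hx
        rw [hmem] at hx ⊢
        intro i
        rw [← hT, ← hT, hTJ, h4, map_smulₛₗ, inner_neg_left, inner_smul_left, inner_smul_left,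
          (hx i).1, (hx i).2]
        simp)
      (by
        intro x hx
        rw [hmem] at hx ⊢
        intro i
        refine ⟨?_, ?_⟩
        · have := hJ (J (u i)) x
          rw [hJJ] at this
          rw [this, ← inner_conj_symm, (hx i).2, map_zero]
        · rw [hJ, ← inner_conj_symm, (hx i).1, map_zero]) hdim
    rw [hmem] at hx
    have hx1 : ∀ i, inner ℂ x (u i) = (0 : ℂ) := fun i => by
      rw [← inner_conj_symm, (hx i).1, map_zero]
    have hx2 : ∀ i, inner ℂ x (J (u i)) = (0 : ℂ) := fun i => by
      rw [← inner_conj_symm, (hx i).2, map_zero]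
    have hx3 : ∀ i, inner ℂ (u i) (J x) = (0 : ℂ) := fun i => by
      have := hJ (J (u i)) x
      rw [hJJ] at this
      rw [this, hx2]
    refine ⟨Fin.cons x u, Fin.cons m l, ?_, ?_, ?_, ?_⟩
    · intro i j
      refine Fin.cases ?_ (fun i => ?_) i <;> refine Fin.cases ?_ (fun j => ?_) j
      · simpa only [Fin.cons_zero, if_true] using hxx
      · simp [hx1, (Fin.succ_ne_zero j).symm]
      · simp [(hx i).1]
      · simp [h1]
    · intro i j
      refine Fin.cases ?_ (fun i => ?_) i <;> refine Fin.cases ?_ (fun j => ?_) j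
      · simp [hxJ]
      · simp [hx2]
      · simp [hx3]
      · simp [h2]
    · intro i
      refine Fin.cases ?_ (fun i => ?_) i
      · simpa using hm
      · simpa using h3 i
    · intro i
      refine Fin.cases ?_ (fun i => ?_) i
      · simpa using hTx
      · simpa using h4 i

end abstractLemmas

/-- The conjugation `(f, g) ↦ (conj g, conj f)`. -/
noncomputable def fbdJ (n : ℕ) : EuclideanSpace ℂ (Fin n ⊕ Fin n) →ₛₗ[starRingEnd ℂ]
    EuclideanSpace ℂ (Fin n ⊕ Fin n) where
  toFun x := WithLp.toLp 2 (fun s => starRingEnd ℂ (x s.swap))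
  map_add' x y := by ext s; simp
  map_smul' c x := by ext s; simp

theorem fbdJ_apply (n : ℕ) (x : EuclideanSpace ℂ (Fin n ⊕ Fin n)) (s : Fin n ⊕ Fin n) :
    fbdJ n x s = starRingEnd ℂ (x s.swap) := rfl

/-- diagonalization of fermionic block operators, finite dimension.
For `P` Hermitian and `Q` antisymmetric, the Hermitian block matrix
`B = [[P, Q], [−Q̄, −P̄]]`, provided `dim Ker(B)` is even, can be brought by a
unitary `𝒰 = [[A₀, B₀], [B̄₀, Ā₀]]` to the form `𝒰 B 𝒰* = [[ξ, 0], [0, −ξ̄]]`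
with `ξ` Hermitian positive semidefinite; if `B` is invertible, `ξ` can be chosen
positive definite. -/
theorem fermionic_block_diagonalization {n : ℕ}
    (P Q : Matrix (Fin n) (Fin n) ℂ) (hP : Pᴴ = P) (hQ : Qᵀ = -Q)
    (B : Matrix (Fin n ⊕ Fin n) (Fin n ⊕ Fin n) ℂ)
    (hB : B = Matrix.fromBlocks P Q (-(Mconj Q)) (-(Mconj P)))
    (hker : Even (Module.finrank ℂ (LinearMap.ker B.mulVecLin))) :
    ∃ A₀ B₀ ξ : Matrix (Fin n) (Fin n) ℂ,
      (let U : Matrix (Fin n ⊕ Fin n) (Fin n ⊕ Fin n) ℂ :=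
        Matrix.fromBlocks A₀ B₀ (Mconj B₀) (Mconj A₀)
       Uᴴ * U = 1 ∧ U * Uᴴ = 1 ∧
         ξ.PosSemidef ∧
         U * B * Uᴴ = Matrix.fromBlocks ξ 0 0 (-(Mconj ξ)) ∧
         (IsUnit B → ξ.PosDef)) := by
  have hQ' : ∀ i j, Q i j = - Q j i := fun i j => by
    have := congrFun (congrFun hQ j) i
    simpa using this
  have hP' : ∀ i j, starRingEnd ℂ (P i j) = P j i := fun i j => by
    have := congrFun (congrFun hP j) i
    simpa using this
  have hH : B.IsHermitian := by
    rw [hB]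
    ext i j
    rcases i with i | i <;> rcases j with j | j
    · simpa using hP' j i
    · simp [Mconj, hQ' i j]
    · simp [Mconj, hQ' j i]
    · simp [Mconj, hP']
  set T := Matrix.toEuclideanLin B with hTdef
  have hTs : T.IsSymmetric := Matrix.isSymmetric_toEuclideanLin_iff.2 hH
  have hTapp : ∀ x s, T x s = ∑ t, B s t * x t := fun x s => rfl
  obtain ⟨u, l, h1, h2, h3, h4⟩ := fbd_family T hTs (fbdJ n)
    (fun x => by ext s; simp [fbdJ_apply])
    (fun x y => by
      simp only [PiLp.inner_apply, fbdJ_apply, Fintype.sum_sum_type]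
      rw [add_comm]
      simp [mul_comm])
    (fun x => by
      ext s
      rw [PiLp.neg_apply, hTapp, fbdJ_apply, hTapp]
      subst hB
      rcases s with s | s <;>
      simp [Mconj, fbdJ_apply, Fintype.sum_sum_type, add_comm])
    n (by simp; omega)
  have h1' : ∀ i j, ∑ t, starRingEnd ℂ (u i t) * u j t = if i = j then 1 else 0 := fun i j => by
    rw [← h1 i j, PiLp.inner_apply]; simp [mul_comm]
  have h2' : ∀ i j, ∑ t : Fin n ⊕ Fin n, starRingEnd ℂ (u i t) * starRingEnd ℂ (u j t.swap) = 0 :=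
    fun i j => by
    rw [← h2 i j, PiLp.inner_apply]; simp [mul_comm, fbdJ_apply]
  have h4' : ∀ i s, ∑ t, B s t * u i t = l i * u i s := fun i s => by
    rw [← hTapp, h4]; simp
  have h2c : ∀ i j, ∑ t : Fin n ⊕ Fin n, u i t * u j t.swap = 0 := fun i j => by
    have := congrArg (starRingEnd ℂ) (h2' i j)
    simpa using this
  have h1c : ∀ i j, ∑ t, u i t * starRingEnd ℂ (u j t) = if i = j then 1 else 0 := fun i j => by
    have := congrArg (starRingEnd ℂ) (h1' i j)
    rw [map_sum] at this
    simpa [apply_ite] using this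
  let A₀ : Matrix (Fin n) (Fin n) ℂ := Matrix.of fun i j => starRingEnd ℂ (u i (Sum.inl j))
  let B₀ : Matrix (Fin n) (Fin n) ℂ := Matrix.of fun i j => starRingEnd ℂ (u i (Sum.inr j))
  let ξ : Matrix (Fin n) (Fin n) ℂ := Matrix.diagonal fun i => (l i : ℂ)
  refine ⟨A₀, B₀, ξ, ?_⟩
  intro U
  have hUU : U * Uᴴ = 1 := by
    ext i j
    rw [Matrix.mul_apply]
    rcases i with i | i <;> rcases j with j | j
    · simpa [U, A₀, B₀, Mconj, Matrix.one_apply, Fintype.sum_sum_type] using h1' i j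
    · simpa [U, A₀, B₀, Mconj, Matrix.one_apply, Fintype.sum_sum_type] using h2' i j
    · simpa [U, A₀, B₀, Mconj, Matrix.one_apply, Fintype.sum_sum_type, add_comm] using h2c i j
    · simpa [U, A₀, B₀, Mconj, Matrix.one_apply, Fintype.sum_sum_type, add_comm] using h1c i j
  have hBU : B * Uᴴ = Uᴴ * Matrix.fromBlocks ξ 0 0 (-(Mconj ξ)) := by
    have hξ : Matrix.fromBlocks ξ 0 0 (-(Mconj ξ)) =
        Matrix.diagonal (Sum.elim (fun i => (l i : ℂ)) (fun i => -(l i : ℂ))) := by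
      ext i j
      rcases i with i | i <;> rcases j with j | j <;>
        simp [ξ, Mconj, Matrix.diagonal_apply]
    rw [hξ]
    ext s j
    rw [Matrix.mul_diagonal, Matrix.mul_apply]
    rcases j with j | j
    · have := h4' j s
      rcases s with s | s <;>
      simpa [U, A₀, B₀, Mconj, Fintype.sum_sum_type, mul_comm] using this
    · have := congrArg (starRingEnd ℂ) (h4' j s.swap)
      subst hB
      rcases s with s | s
      · simp [U, A₀, B₀, Mconj, Fintype.sum_sum_type] at this ⊢
        linear_combination -this
      · simp [U, A₀, B₀, Mconj, Fintype.sum_sum_type] at this ⊢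
        linear_combination -this
  have hUU' : Uᴴ * U = 1 := mul_eq_one_comm.1 hUU
  refine ⟨hUU', hUU, ?_, ?_, ?_⟩
  · refine Matrix.PosSemidef.diagonal ?_
    intro i
    show (0 : ℂ) ≤ (l i : ℂ)
    exact_mod_cast h3 i
  · rw [Matrix.mul_assoc, hBU, ← Matrix.mul_assoc, hUU, Matrix.one_mul]
  · intro hu
    refine Matrix.PosDef.diagonal ?_
    intro i
    have hne : l i ≠ 0 := by
      intro h0
      have hz : B *ᵥ (u i).ofLp = 0 := by
        ext s
        have := h4' i s
        rw [h0] at this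
        simpa [Matrix.mulVec, dotProduct] using this
      have hui : (u i).ofLp = 0 := by
        apply Matrix.mulVec_injective_of_isUnit hu
        rw [hz, Matrix.mulVec_zero]
      have := h1' i i
      simp [hui] at this
    have : 0 < l i := lt_of_le_of_ne (h3 i) (Ne.symm hne)
    exact_mod_cast this
end
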